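/- arXiv:2310.18452 — 4 statements merged into one kernel-verified Lean document; each statement's English description precedes it below -/
import Mathlib

section
/- Fix ε ∈ (0, 1/10) and suppose n is sufficiently large with respect to ε. Let G be an n-vertex graph with no independent set of size √n. Then G has either an induced subgraph G' on n' vertices with n' ≥ n^{1/4} and average degree d(G') ≥ (n')^{1 − 5ε}, or an induced subgraph G'' which contains no cycle of length 4 and has average degree d(G'') ≥ n^{ε/100}. -/
open Finset

/-- The average degree `2|E|/|V|` of a finite simple graph. -/
noncomputable def avgDeg {V : Type*} [Fintype V] (G : SimpleGraph V) : ℝ :=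
  2 * G.edgeSet.ncard / Fintype.card V

/-- The degree of a vertex. -/
noncomputable def deg {V : Type*} (G : SimpleGraph V) (v : V) : ℕ :=
  (G.neighborSet v).ncard

/-- `G` contains `K_{s,s}` as a (not necessarily induced) subgraph. -/
def HasKssSubgraph {V : Type*} (G : SimpleGraph V) (s : ℕ) : Prop :=
  ∃ f : completeBipartiteGraph (Fin s) (Fin s) →g G, Function.Injective f

/-- `G` contains no cycle of length 4, even as a non-induced subgraph. -/
def C4Free {V : Type*} (G : SimpleGraph V) : Prop :=
  ¬ ∃ a b c d : V, a ≠ b ∧ a ≠ c ∧ a ≠ d ∧ b ≠ c ∧ b ≠ d ∧ c ≠ d ∧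
      G.Adj a b ∧ G.Adj b c ∧ G.Adj c d ∧ G.Adj d a

/-- The balanced subdivision of `K_h` in which every edge of `K_h` is replaced by a
path with exactly `ℓ` edges (intended for `ℓ ≥ 2`): branch vertices are `Fin h`,
and each pair `a < b` gets a path of `ℓ - 1` new internal vertices. -/
def balancedSubdivision (h ℓ : ℕ) :
    SimpleGraph (Fin h ⊕ ({p : Fin h × Fin h // p.1 < p.2} × Fin (ℓ - 1))) :=
  SimpleGraph.fromRel (fun x y =>
    match x, y with
    | Sum.inl u, Sum.inr ⟨⟨⟨a, b⟩, _⟩, i⟩ => (u = a ∧ (i : ℕ) = 0) ∨ (u = b ∧ (i : ℕ) = ℓ - 2)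
    | Sum.inr ⟨e, i⟩, Sum.inr ⟨e', j⟩ => e = e' ∧ (j : ℕ) = (i : ℕ) + 1
    | _, _ => False)

/-- `G` contains an induced proper balanced subdivision of `K_h`. -/
def HasInducedBalancedSubdivision {V : Type*} (G : SimpleGraph V) (h : ℕ) : Prop :=
  ∃ ℓ : ℕ, 2 ≤ ℓ ∧ Nonempty (balancedSubdivision h ℓ ↪g G)

/-- The number of edges of `G` with one endpoint in `A` and the other in `B`
(for disjoint `A`, `B`). -/
noncomputable def crossEdges {V : Type*} (G : SimpleGraph V) (A B : Set V) : ℕ :=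
  Set.ncard {p : V × V | p.1 ∈ A ∧ p.2 ∈ B ∧ G.Adj p.1 p.2}

/-- `G` is `d`-degenerate: every (induced) subgraph has a vertex of degree at most `d`. -/
def Degenerate {V : Type*} (G : SimpleGraph V) (d : ℕ) : Prop :=
  ∀ s : Finset V, s.Nonempty → ∃ v ∈ s, ((s : Set V) ∩ G.neighborSet v).ncard ≤ d

/-- The 1-subdivision of the multihypergraph with hyperedges `edges e`, `e : E`,
on vertex set `V`. -/
def oneSubdivision {E V : Type*} (edges : E → Finset V) : SimpleGraph (E ⊕ V) :=
  SimpleGraph.fromRel (fun x y =>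
    match x, y with
    | Sum.inl a, Sum.inr b => b ∈ edges a
    | _, _ => False)

/-- The 1-subdivision of a simple graph `G`. -/
def graphOneSubdivision {W : Type*} (G : SimpleGraph W) : SimpleGraph (G.edgeSet ⊕ W) :=
  SimpleGraph.fromRel (fun x y =>
    match x, y with
    | Sum.inl e, Sum.inr w => w ∈ (e : Sym2 W)
    | _, _ => False)

/-- `I` is an independent set of `G`. -/
def IndepSet {V : Type*} (G : SimpleGraph V) (I : Set V) : Prop :=
  I.Pairwise fun u v => ¬ G.Adj u v

/-- `G` has a clique on `k` vertices. -/
def HasClique {V : Type*} (G : SimpleGraph V) (k : ℕ) : Prop :=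
  ∃ t : Finset V, G.IsNClique k t


section PairCounting

variable {V : Type*}

open scoped Classical in
/-- The number of ordered adjacent pairs `(a, b)` with `a ∈ A` and `b ∈ B`. -/
noncomputable def adjPairs (G : SimpleGraph V) (A B : Finset V) : ℝ :=
  ∑ a ∈ A, ∑ b ∈ B, if G.Adj a b then 1 else 0

open scoped Classical in
lemma adjPairs_eq_card (G : SimpleGraph V) (A B : Finset V) :
    adjPairs G A B = #{p ∈ A ×ˢ B | G.Adj p.1 p.2} := by
  rw [adjPairs, Finset.card_filter, Finset.sum_product]
  push_cast
  rfl

lemma adjPairs_nonneg (G : SimpleGraph V) (A B : Finset V) : 0 ≤ adjPairs G A B := by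
  classical
  rw [adjPairs_eq_card]
  positivity

lemma adjPairs_comm (G : SimpleGraph V) (A B : Finset V) : adjPairs G A B = adjPairs G B A := by
  classical
  rw [adjPairs, adjPairs, Finset.sum_comm]
  exact Finset.sum_congr rfl fun b _ => Finset.sum_congr rfl fun a _ =>
    if_congr (G.adj_comm a b) rfl rfl

lemma adjPairs_mono (G : SimpleGraph V) {A A' B B' : Finset V} (hA : A ⊆ A') (hB : B ⊆ B') :
    adjPairs G A B ≤ adjPairs G A' B' := by
  classical
  rw [adjPairs_eq_card, adjPairs_eq_card]
  exact_mod_cast Finset.card_le_card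
    (Finset.filter_subset_filter _ (Finset.product_subset_product hA hB))

lemma adjPairs_le_mul (G : SimpleGraph V) (A B : Finset V) :
    adjPairs G A B ≤ #A * #B := by
  classical
  rw [adjPairs_eq_card]
  exact_mod_cast (Finset.card_filter_le _ _).trans_eq (Finset.card_product _ _)

lemma adjPairs_union_left [DecidableEq V] (G : SimpleGraph V) {A A' : Finset V}
    (h : Disjoint A A') (B : Finset V) :
    adjPairs G (A ∪ A') B = adjPairs G A B + adjPairs G A' B :=
  Finset.sum_union h

lemma adjPairs_union_self [DecidableEq V] (G : SimpleGraph V) {A B : Finset V}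
    (h : Disjoint A B) :
    adjPairs G (A ∪ B) (A ∪ B) = adjPairs G A A + 2 * adjPairs G A B + adjPairs G B B := by
  rw [adjPairs_union_left G h, adjPairs_comm G A, adjPairs_comm G B,
    adjPairs_union_left G h, adjPairs_union_left G h, adjPairs_comm G B A]
  ring

lemma adjPairs_eq_sum_singleton (G : SimpleGraph V) (A B : Finset V) :
    adjPairs G A B = ∑ a ∈ A, adjPairs G {a} B := by
  simp [adjPairs]

open scoped Classical in
lemma adjPairs_singleton_eq_card (G : SimpleGraph V) (a : V) (B : Finset V) :
    adjPairs G {a} B = #{b ∈ B | G.Adj a b} := by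
  simp [adjPairs]

lemma avgDeg_induce (G : SimpleGraph V) (S : Finset V) :
    avgDeg (G.induce (S : Set V)) = adjPairs G S S / #S := by
  classical
  have hcard : Fintype.card (S : Set V) = #S := by simp
  have hedges : (2 * (G.induce (S : Set V)).edgeSet.ncard : ℝ) = adjPairs G S S := by
    have h := (G.induce (S : Set V)).sum_degrees_eq_twice_card_edges
    rw [← SimpleGraph.coe_edgeFinset, Set.ncard_coe_finset]
    have h' : (2 * #(G.induce (S : Set V)).edgeFinset : ℝ) =
        ∑ v : (S : Set V), ((G.induce (S : Set V)).degree v : ℝ) := by exact_mod_cast h.symm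
    rw [h', adjPairs_eq_sum_singleton, ← Finset.sum_coe_sort S]
    refine Finset.sum_congr rfl fun v _ => ?_
    rw [adjPairs_singleton_eq_card, ← SimpleGraph.card_neighborFinset_eq_degree]
    congr 1
    refine Finset.card_bij (fun x _ => x.1) ?_ ?_ ?_
    · rintro ⟨x, hx⟩ h
      simpa using ⟨hx, by simpa using h⟩
    · intro a _ b _ h
      exact Subtype.ext h
    · intro b hb
      simp only [Finset.mem_filter] at hb
      exact ⟨⟨b, hb.1⟩, by simpa using hb.2, rfl⟩
  unfold avgDeg
  rw [hedges]
  congr 2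

end PairCounting

section RandomSubset

variable {V : Type*} [DecidableEq V]

/-- The expectation of `F` at a random subset of `L` that contains every element of `L`
independently with probability `p`. -/
noncomputable def subsetExp (p : ℝ) (L : Finset V) (F : Finset V → ℝ) : ℝ :=
  ∑ S ∈ L.powerset, (p ^ #S * (1 - p) ^ #(L \ S)) * F S

lemma subsetExp_sub (p : ℝ) (L : Finset V) (F F' : Finset V → ℝ) :
    subsetExp p L (fun S => F S - F' S) = subsetExp p L F - subsetExp p L F' := by
  simp [subsetExp, mul_sub]

lemma subsetExp_const_mul (p c : ℝ) (L : Finset V) (F : Finset V → ℝ) :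
    subsetExp p L (fun S => c * F S) = c * subsetExp p L F := by
  simp only [subsetExp, Finset.mul_sum]
  exact Finset.sum_congr rfl fun _ _ => by ring

lemma subsetExp_indicator (p : ℝ) {L A : Finset V} (hA : A ⊆ L) :
    subsetExp p L (fun S => if A ⊆ S then 1 else 0) = p ^ #A := by
  have h := Finset.prod_add (fun _ : V => p) (fun i => if i ∈ A then 0 else 1 - p) L
  have hl : ∏ i ∈ L, (p + if i ∈ A then 0 else 1 - p) = p ^ #A := by
    have : ∀ i, (p + if i ∈ A then 0 else 1 - p) = if i ∈ A then p else 1 := by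
      intro i; split_ifs <;> ring
    simp only [this]
    rw [Finset.prod_ite_mem, Finset.inter_eq_right.2 hA, Finset.prod_const]
  rw [← hl, h, subsetExp]
  refine Finset.sum_congr rfl fun S _ => ?_
  rw [Finset.prod_const, mul_assoc]
  congr 1
  split_ifs with hS
  · rw [mul_one, ← Finset.prod_const]
    refine Finset.prod_congr rfl fun i hi => ?_
    rw [if_neg fun hiA => (Finset.mem_sdiff.1 hi).2 (hS hiA)]
  · obtain ⟨i, hiA, hiS⟩ := Finset.not_subset.1 hS
    rw [mul_zero, eq_comm]
    exact Finset.prod_eq_zero (Finset.mem_sdiff.2 ⟨hA hiA, hiS⟩) (if_pos hiA)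

lemma subsetExp_card_filter {ι : Type*} (p : ℝ) {L : Finset V} (J : Finset ι)
    (A : ι → Finset V) (hA : ∀ i ∈ J, A i ⊆ L) :
    subsetExp p L (fun S => (#{i ∈ J | A i ⊆ S} : ℝ)) = ∑ i ∈ J, p ^ #(A i) := by
  simp only [Finset.card_filter, Nat.cast_sum, Nat.cast_ite, Nat.cast_one, Nat.cast_zero]
  rw [subsetExp]
  simp only [Finset.mul_sum]
  rw [Finset.sum_comm]
  exact Finset.sum_congr rfl fun i hi => subsetExp_indicator p (hA i hi)

lemma exists_pos_of_subsetExp_pos {p : ℝ} (hp0 : 0 ≤ p) (hp1 : p ≤ 1) {L : Finset V}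
    {F : Finset V → ℝ} (h : 0 < subsetExp p L F) : ∃ S ⊆ L, 0 < F S := by
  by_contra! hcon
  refine h.not_ge (Finset.sum_nonpos fun S hS => ?_)
  exact mul_nonpos_of_nonneg_of_nonpos
    (mul_nonneg (pow_nonneg hp0 _) (pow_nonneg (sub_nonneg.2 hp1) _))
    (hcon S (Finset.mem_powerset.1 hS))

end RandomSubset

section Deletion

variable {V : Type*}

/-- `(a, b, c, d)` traverses a cycle of length four in `G`. -/
def IsFourCycle (G : SimpleGraph V) (q : V × V × V × V) : Prop :=
  q.1 ≠ q.2.2.1 ∧ q.2.1 ≠ q.2.2.2 ∧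
    G.Adj q.1 q.2.1 ∧ G.Adj q.2.1 q.2.2.1 ∧ G.Adj q.2.2.1 q.2.2.2 ∧ G.Adj q.2.2.2 q.1

open scoped Classical in
/-- The four-cycles of `G` with all vertices in `L`. -/
noncomputable def fourCycles (G : SimpleGraph V) (L : Finset V) : Finset (V × V × V × V) :=
  {q ∈ L ×ˢ L ×ˢ L ×ˢ L | IsFourCycle G q}

open scoped Classical in
/-- The four-cycles of `G` in `L` together with a neighbour in `L` of their first vertex. -/
noncomputable def rootedFourCycles (G : SimpleGraph V) (L : Finset V) :
    Finset ((V × V × V × V) × V) :=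
  {r ∈ fourCycles G L ×ˢ L | G.Adj r.1.1 r.2}

/-- The vertex set of a four-tuple. -/
def tupleSupport [DecidableEq V] (q : V × V × V × V) : Finset V :=
  {q.1, q.2.1, q.2.2.1, q.2.2.2}

lemma card_tupleSupport_of_isFourCycle [DecidableEq V] {G : SimpleGraph V}
    {q : V × V × V × V} (h : IsFourCycle G q) : #(tupleSupport q) = 4 := by
  obtain ⟨a, b, c, d⟩ := q
  obtain ⟨hac, hbd, hab, hbc, hcd, hda⟩ := h
  have := hab.ne
  have := hbc.ne
  have := hcd.ne
  have := hda.ne'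
  simp_all [tupleSupport]

/-- Deleting all vertices that lie on four-cycles destroys at most twice as many ordered
adjacent pairs as there are rooted four-cycles. -/
lemma exists_c4Free_subset (G : SimpleGraph V) (S : Finset V) :
    ∃ S' ⊆ S, C4Free (G.induce (S' : Set V)) ∧
      adjPairs G S S ≤ adjPairs G S' S' + 2 * #(rootedFourCycles G S) := by
  classical
  set B := S.filter fun a => ∃ q ∈ fourCycles G S, q.1 = a with hB
  have hBS : B ⊆ S := Finset.filter_subset _ _
  refine ⟨S \ B, Finset.sdiff_subset, ?_, ?_⟩
  · rintro ⟨⟨a, ha⟩, ⟨b, hb⟩, ⟨c, hc⟩, ⟨d, hd⟩, -, hac, -, -, hbd, -, hab, hbc, hcd, hda⟩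
    simp only [Finset.coe_sdiff, Set.mem_sdiff, Finset.mem_coe] at ha hb hc hd
    refine ha.2 (Finset.mem_filter.2 ⟨ha.1, (a, b, c, d), ?_, rfl⟩)
    simp only [ne_eq, Subtype.mk.injEq] at hac hbd
    simp only [fourCycles, Finset.mem_filter, Finset.mem_product]
    exact ⟨⟨ha.1, hb.1, hc.1, hd.1⟩, hac, hbd, hab, hbc, hcd, hda⟩
  · have hsplit := adjPairs_union_self G (Finset.sdiff_disjoint (s := B) (t := S)).symm
    have hsplit' := adjPairs_union_left G (Finset.sdiff_disjoint (s := B) (t := S)).symm B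
    rw [Finset.union_sdiff_of_subset hBS] at hsplit hsplit'
    have hle : adjPairs G B S ≤ #(rootedFourCycles G S) := by
      rw [adjPairs_eq_card]
      norm_cast
      refine Finset.card_le_card_of_surjOn (fun r => (r.1.1, r.2)) ?_
      rintro ⟨a, x⟩ hax
      simp only [Finset.coe_filter, Finset.mem_product, Set.mem_ofPred_eq] at hax
      obtain ⟨⟨ha, hx⟩, hadj⟩ := hax
      obtain ⟨-, q, hq, rfl⟩ := Finset.mem_filter.1 ha
      refine ⟨(q, x), ?_, rfl⟩
      simp only [rootedFourCycles, Finset.coe_filter, Finset.mem_product, Set.mem_ofPred_eq]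
      exact ⟨⟨hq, hx⟩, hadj⟩
    rw [adjPairs_comm] at hle
    have := adjPairs_comm G B (S \ B)
    have := adjPairs_nonneg G B B
    linarith

open scoped Classical in
lemma card_fourCycles_le (G : SimpleGraph V) (L : Finset V) {M : ℝ}
    (hM : ∀ a ∈ L, ∀ b ∈ L,
      adjPairs G {c ∈ L | G.Adj b c} {d ∈ L | G.Adj a d} ≤ M) :
    (#(fourCycles G L) : ℝ) ≤ adjPairs G L L * M := by
  have hmaps : ∀ q ∈ fourCycles G L, (q.1, q.2.1) ∈ {p ∈ L ×ˢ L | G.Adj p.1 p.2} := by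
    intro q hq
    simp only [fourCycles, Finset.mem_filter, Finset.mem_product] at hq ⊢
    exact ⟨⟨hq.1.1, hq.1.2.1⟩, hq.2.2.2.1⟩
  rw [Finset.card_eq_sum_card_fiberwise hmaps, adjPairs_eq_card, Nat.cast_sum, ← nsmul_eq_mul]
  refine Finset.sum_le_card_nsmul _ _ _ ?_
  rintro ⟨a, b⟩ hab
  simp only [Finset.mem_filter, Finset.mem_product] at hab
  refine le_trans ?_ (hM a hab.1.1 b hab.1.2)
  rw [adjPairs_eq_card]
  norm_cast
  refine Finset.card_le_card_of_injOn (fun q => q.2.2) ?_ ?_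
  · rintro ⟨a', b', c, d⟩ hq
    simp only [fourCycles, Finset.coe_filter, Finset.mem_filter, Finset.mem_product,
      Set.mem_ofPred_eq, Prod.mk.injEq] at hq
    obtain ⟨⟨⟨-, -, hc, hd⟩, -, -, -, hbc, hcd, hda⟩, rfl, rfl⟩ := hq
    simp only [Finset.coe_filter, Finset.mem_product, Finset.mem_filter, Set.mem_ofPred_eq]
    exact ⟨⟨⟨hc, hbc⟩, hd, hda.symm⟩, hcd⟩
  · rintro ⟨a', b', c, d⟩ hq ⟨a'', b'', c', d'⟩ hq' h
    simp only [Finset.coe_filter, Set.mem_ofPred_eq, Prod.mk.injEq] at hq hq' h ⊢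
    grind

lemma filter_rootedFourCycles [DecidableEq V] (G : SimpleGraph V) {S L : Finset V}
    (hS : S ⊆ L) :
    {r ∈ rootedFourCycles G L | tupleSupport r.1 ∪ {r.2} ⊆ S} = rootedFourCycles G S := by
  ext ⟨⟨a, b, c, d⟩, x⟩
  simp only [rootedFourCycles, fourCycles, Finset.mem_filter, Finset.mem_product,
    tupleSupport, Finset.union_subset_iff, Finset.insert_subset_iff,
    Finset.singleton_subset_iff]
  constructor
  · rintro ⟨⟨⟨⟨-, hq⟩, -⟩, hx⟩, hsub, hxS⟩
    exact ⟨⟨⟨hsub, hq⟩, hxS⟩, hx⟩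
  · rintro ⟨⟨⟨⟨ha, hb, hc, hd⟩, hq⟩, hxS⟩, hx⟩
    exact ⟨⟨⟨⟨⟨hS ha, hS hb, hS hc, hS hd⟩, hq⟩, hS hxS⟩, hx⟩, ⟨ha, hb, hc, hd⟩, hxS⟩

lemma sum_rootedFourCycles_le [DecidableEq V] (G : SimpleGraph V) (L : Finset V) {p D : ℝ}
    (hp : 0 ≤ p) (hD : ∀ a ∈ L, adjPairs G {a} L ≤ D) :
    ∑ r ∈ rootedFourCycles G L, p ^ #(tupleSupport r.1 ∪ {r.2}) ≤
      #(fourCycles G L) * (p ^ 5 * D + 4 * p ^ 4) := by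
  classical
  rw [rootedFourCycles, Finset.sum_filter, Finset.sum_product, ← nsmul_eq_mul]
  refine Finset.sum_le_card_nsmul _ _ _ fun q hq => ?_
  obtain ⟨hqL, hcyc⟩ := Finset.mem_filter.1 hq
  have hcard := card_tupleSupport_of_isFourCycle hcyc
  have ha := hD q.1 (Finset.mem_product.1 hqL).1
  calc ∑ x ∈ L, (if G.Adj q.1 x then p ^ #(tupleSupport q ∪ {x}) else 0)
      ≤ ∑ x ∈ L, (p ^ 5 * (if G.Adj q.1 x then 1 else 0) +
          (if x ∈ tupleSupport q then p ^ 4 else 0)) := by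
        refine Finset.sum_le_sum fun x _ => ?_
        by_cases hx : x ∈ tupleSupport q
        · rw [Finset.union_eq_left.2 (Finset.singleton_subset_iff.2 hx), hcard, if_pos hx]
          split_ifs <;> simp [pow_nonneg hp]
        · rw [Finset.card_union_of_disjoint (Finset.disjoint_singleton_right.2 hx), hcard,
            if_neg hx]
          split_ifs <;> simp
    _ = p ^ 5 * adjPairs G {q.1} L + #(L ∩ tupleSupport q) * p ^ 4 := by
        rw [Finset.sum_add_distrib, ← Finset.mul_sum, Finset.sum_ite_mem, Finset.sum_const,
          nsmul_eq_mul, adjPairs, Finset.sum_singleton]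
    _ ≤ p ^ 5 * D + 4 * p ^ 4 := by
        have : (#(L ∩ tupleSupport q) : ℝ) ≤ 4 := by
          exact_mod_cast hcard ▸ Finset.card_le_card (Finset.inter_subset_right (s₁ := L))
        gcongr

/-- Sampling the vertices of `L` with probability `p` and deleting the vertices on four-cycles
produces a `C₄`-free induced subgraph of large average degree. -/
lemma exists_c4Free_of_sampling (G : SimpleGraph V) (L : Finset V) {p D M T : ℝ}
    (hp0 : 0 ≤ p) (hp1 : p ≤ 1) (hT : 0 ≤ T)
    (hD : ∀ a ∈ L, adjPairs G {a} L ≤ D)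
    (hM : ∀ W ⊆ L, (#W : ℝ) ≤ 2 * D → adjPairs G W W ≤ M)
    (hpos : 0 < p ^ 2 * adjPairs G L L
      - 2 * (adjPairs G L L * M * (p ^ 5 * D + 4 * p ^ 4)) - T * (p * #L)) :
    ∃ S : Finset V, C4Free (G.induce (S : Set V)) ∧ T ≤ avgDeg (G.induce (S : Set V)) := by
  classical
  have hedges : subsetExp p L (fun S => adjPairs G S S) = p ^ 2 * adjPairs G L L := by
    have h := subsetExp_card_filter p {q ∈ L ×ˢ L | G.Adj q.1 q.2} (fun q => {q.1, q.2})
      (L := L) (by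
        intro q hq
        simp only [Finset.mem_filter, Finset.mem_product] at hq
        simp [Finset.insert_subset_iff, hq])
    have hsum : ∑ q ∈ L ×ˢ L with G.Adj q.1 q.2, p ^ #({q.1, q.2} : Finset V) =
        p ^ 2 * adjPairs G L L := by
      rw [adjPairs_eq_card, mul_comm, ← nsmul_eq_mul]
      refine Finset.sum_eq_card_nsmul fun q hq => ?_
      rw [Finset.card_pair (Finset.mem_filter.1 hq).2.ne]
    rw [← hsum, ← h]
    refine Finset.sum_congr rfl fun S hS => ?_
    dsimp only
    rw [adjPairs_eq_card]
    congr 3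
    ext q
    have := Finset.mem_powerset.1 hS
    simp only [Finset.mem_filter, Finset.mem_product, Finset.insert_subset_iff,
      Finset.singleton_subset_iff]
    grind
  have hverts : subsetExp p L (fun S => (#S : ℝ)) = p * #L := by
    have h := subsetExp_card_filter p L (fun v => {v}) (L := L) (by simp)
    simp only [Finset.card_singleton, pow_one, Finset.sum_const, nsmul_eq_mul] at h
    rw [mul_comm, ← h]
    refine Finset.sum_congr rfl fun S hS => ?_
    congr 3
    ext v
    have := Finset.mem_powerset.1 hS
    simp only [Finset.mem_filter, Finset.singleton_subset_iff]
    grind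
  have hcycles : subsetExp p L (fun S => (#(rootedFourCycles G S) : ℝ)) ≤
      adjPairs G L L * M * (p ^ 5 * D + 4 * p ^ 4) := by
    have h := subsetExp_card_filter p (rootedFourCycles G L)
      (fun r => tupleSupport r.1 ∪ {r.2}) (L := L) (by
        intro r hr
        simp only [rootedFourCycles, fourCycles, Finset.mem_filter, Finset.mem_product] at hr
        simp [tupleSupport, Finset.insert_subset_iff, hr])
    have hfilter : subsetExp p L (fun S => (#(rootedFourCycles G S) : ℝ)) =
        ∑ r ∈ rootedFourCycles G L, p ^ #(tupleSupport r.1 ∪ {r.2}) := by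
      rw [← h]
      refine Finset.sum_congr rfl fun S hS => ?_
      dsimp only
      rw [filter_rootedFourCycles G (Finset.mem_powerset.1 hS)]
    rw [hfilter]
    refine (sum_rootedFourCycles_le G L hp0 hD).trans ?_
    rcases L.eq_empty_or_nonempty with rfl | ⟨v, hv⟩
    · simp [fourCycles, adjPairs]
    have hD0 : 0 ≤ D := (adjPairs_nonneg G _ _).trans (hD v hv)
    refine mul_le_mul_of_nonneg_right (card_fourCycles_le G L fun a ha b hb => ?_) (by positivity)
    refine le_trans (adjPairs_mono G Finset.subset_union_left Finset.subset_union_right)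
      (hM ({c ∈ L | G.Adj b c} ∪ {d ∈ L | G.Adj a d}) ?_ ?_)
    · exact Finset.union_subset (Finset.filter_subset _ _) (Finset.filter_subset _ _)
    · have h1 := hD a ha
      have h2 := hD b hb
      rw [adjPairs_singleton_eq_card] at h1 h2
      have h3 : (#({c ∈ L | G.Adj b c} ∪ {d ∈ L | G.Adj a d}) : ℝ) ≤
          #{c ∈ L | G.Adj b c} + #{d ∈ L | G.Adj a d} := by
        exact_mod_cast Finset.card_union_le _ _
      linarith
  obtain ⟨S, -, hS⟩ := exists_pos_of_subsetExp_pos hp0 hp1 (L := L)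
    (F := fun S => adjPairs G S S - 2 * #(rootedFourCycles G S) - T * #S) (by
      rw [subsetExp_sub, subsetExp_sub, subsetExp_const_mul, subsetExp_const_mul, hedges, hverts]
      linarith)
  obtain ⟨S', hS'S, hfree, hle⟩ := exists_c4Free_subset G S
  refine ⟨S', hfree, ?_⟩
  have hcard : (#S' : ℝ) ≤ #S := by exact_mod_cast Finset.card_le_card hS'S
  have hTc : T * #S' ≤ T * #S := by gcongr
  have hne : 0 < (#S' : ℝ) := by
    rw [Nat.cast_pos, Finset.card_pos, Finset.nonempty_iff_ne_empty]
    rintro rfl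
    simp only [adjPairs, Finset.sum_empty] at hle
    have : 0 ≤ T * #S := by positivity
    simp only [adjPairs] at hS
    linarith
  rw [avgDeg_induce, le_div_iff₀ hne]
  linarith

end Deletion

section Regularization

variable {V : Type*}

/-- If every set of at most `k` elements has `f`-weight at most `B`, then any set `L` has weight
at most `(|L| / k + 1) B`. -/
lemma sum_le_of_small_subsets (f : V → ℝ) {k : ℕ} (hk : 0 < k) {B : ℝ} (hB : 0 ≤ B)
    (L : Finset V) (h : ∀ P ⊆ L, #P ≤ k → ∑ v ∈ P, f v ≤ B) :
    ∑ v ∈ L, f v ≤ ((#L : ℝ) / k + 1) * B := by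
  classical
  have hk' : (0 : ℝ) < k := by exact_mod_cast hk
  induction L using Finset.strongInduction with
  | H L ih =>
    rcases le_total (#L) k with hle | hle
    · calc ∑ v ∈ L, f v ≤ 1 * B := by simpa using h L subset_rfl hle
        _ ≤ ((#L : ℝ) / k + 1) * B := by
          gcongr
          exact le_add_of_nonneg_left (by positivity)
    · obtain ⟨P, hPL, hP⟩ := Finset.exists_subset_card_eq hle
      have hss : L \ P ⊂ L := Finset.sdiff_ssubset hPL (Finset.card_pos.1 (hP ▸ hk))
      have h1 := ih (L \ P) hss fun Q hQ => h Q (hQ.trans Finset.sdiff_subset)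
      have h2 := h P hPL hP.le
      have h3 : (#(L \ P) : ℝ) = #L - k := by
        rw [Finset.card_sdiff_of_subset hPL, hP, Nat.cast_sub hle]
      rw [h3, sub_div, div_self hk'.ne'] at h1
      rw [← Finset.sum_sdiff hPL]
      linarith

/-- Among the vertices of a graph with no large independent set, the number of adjacent pairs is
large. -/
lemma le_adjPairs_univ_of_no_indepSet [Fintype V] (G : SimpleGraph V)
    (hn : 16 < Fintype.card V)
    (h : ¬ ∃ I : Finset V, (#I : ℝ) ≥ √(Fintype.card V) ∧ IndepSet G (I : Set V)) :
    (Fintype.card V : ℝ) * √(Fintype.card V) / 8 ≤ adjPairs G univ univ := by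
  classical
  set n := (Fintype.card V : ℝ)
  set t : ℝ := √n / 4 with ht
  have hsq : √n * √n = n := Real.mul_self_sqrt (by positivity)
  have hn' : (16 : ℝ) < n := by simpa [n] using (Nat.cast_lt (α := ℝ)).2 hn
  have hs4 : 4 < √n := Real.lt_sqrt_of_sq_lt (by linarith)
  set low := univ.filter fun v => adjPairs G {v} univ < t
  have hlow : (#low : ℝ) ≤ n / 2 := by
    by_contra! hcon
    obtain ⟨I, hI⟩ := (low.powerset.filter fun I : Finset V => IndepSet G (I : Set V)).exists_maximal
      ⟨∅, Finset.mem_filter.2 ⟨Finset.empty_mem_powerset _, by simp [IndepSet]⟩⟩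
    obtain ⟨hIlow, hind⟩ := Finset.mem_filter.1 hI.prop
    rw [Finset.mem_powerset] at hIlow
    have hcover : low ⊆ I.biUnion fun u => insert u (univ.filter fun v => G.Adj u v) := by
      intro v hv
      by_contra hnot
      simp only [Finset.mem_biUnion, Finset.mem_insert, Finset.mem_filter, Finset.mem_univ,
        true_and, not_exists, not_and, not_or] at hnot
      have hvI : v ∉ I := fun hvI => (hnot v hvI).1 rfl
      have hins : IndepSet G (insert v I : Finset V) := by
        rw [IndepSet, Finset.coe_insert]
        exact Set.Pairwise.insert hind fun u hu _ =>
          ⟨fun hadj => (hnot u hu).2 hadj.symm, (hnot u hu).2⟩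
      refine hvI (hI.le_of_ge (Finset.mem_filter.2 ⟨?_, hins⟩) (Finset.subset_insert v I)
        (Finset.mem_insert_self v I))
      exact Finset.mem_powerset.2 (Finset.insert_subset hv hIlow)
    have hcard : (#low : ℝ) ≤ #I * (t + 1) := by
      calc (#low : ℝ) ≤ ∑ u ∈ I, (#(insert u (univ.filter fun v => G.Adj u v)) : ℝ) := by
            exact_mod_cast (Finset.card_le_card hcover).trans Finset.card_biUnion_le
        _ ≤ ∑ u ∈ I, (t + 1) := by
            refine Finset.sum_le_sum fun u hu => ?_
            have hu' := (Finset.mem_filter.1 (hIlow hu)).2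
            rw [adjPairs_singleton_eq_card] at hu'
            have : (#(insert u (univ.filter fun v => G.Adj u v)) : ℝ) ≤
                #(univ.filter fun v => G.Adj u v) + 1 := by
              exact_mod_cast Finset.card_insert_le _ _
            linarith
        _ = #I * (t + 1) := by rw [Finset.sum_const, nsmul_eq_mul]
    refine h ⟨I, ?_, hind⟩
    by_contra! hIs
    nlinarith
  have hhigh : (#(univ \ low) : ℝ) = n - #low := by
    rw [Finset.card_sdiff_of_subset (Finset.subset_univ _), Finset.card_univ,
      Nat.cast_sub (Finset.card_le_univ _)]
  calc n * √n / 8 ≤ #(univ \ low) * t := by rw [hhigh]; nlinarith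
    _ = ∑ v ∈ univ \ low, t := by rw [Finset.sum_const, nsmul_eq_mul]
    _ ≤ ∑ v ∈ univ \ low, adjPairs G {v} univ := by
        refine Finset.sum_le_sum fun v hv => ?_
        simpa [low] using hv
    _ = adjPairs G (univ \ low) univ := (adjPairs_eq_sum_singleton _ _ _).symm
    _ ≤ adjPairs G univ univ := adjPairs_mono G (Finset.subset_univ _) subset_rfl

/-- A vertex set maximising `adjPairs G U U / |U| ^ (1 + c)` loses at most half of its adjacent
pairs when its vertices of degree more than `K` times the average are deleted. -/
lemma exists_almost_regular_subset {G : SimpleGraph V} {U : Finset V} {c K : ℝ}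
    (hc : 0 < c) (hK : 1 ≤ K) (hKc : 24 * 4 ^ c ≤ K ^ c) (hKU : K ≤ #U)
    (hE : 0 < adjPairs G U U)
    (hmax : ∀ W ⊆ U, W.Nonempty →
      adjPairs G W W ≤ adjPairs G U U * ((#W : ℝ) / #U) ^ (1 + c)) :
    ∃ L ⊆ U, adjPairs G U U ≤ 2 * adjPairs G L L ∧
      ∀ v ∈ L, adjPairs G {v} L ≤ K * (adjPairs G U U / #U) := by
  classical
  set E := adjPairs G U U
  set m := (#U : ℝ)
  set d := E / m
  have hK0 : 0 < K := by linarith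
  have hm : 0 < m := by linarith
  have hd : 0 < d := by positivity
  have hdm : d * m = E := div_mul_cancel₀ _ hm.ne'
  set H := U.filter fun v => K * d < adjPairs G {v} U
  have hHU : H ⊆ U := Finset.filter_subset _ _
  have hHcard : (#H : ℝ) ≤ m / K := by
    have h1 : #H * (K * d) ≤ E := by
      calc #H * (K * d) = ∑ v ∈ H, K * d := by rw [Finset.sum_const, nsmul_eq_mul]
        _ ≤ ∑ v ∈ H, adjPairs G {v} U :=
            Finset.sum_le_sum fun v hv => (Finset.mem_filter.1 hv).2.le
        _ = adjPairs G H U := (adjPairs_eq_sum_singleton _ _ _).symm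
        _ ≤ E := adjPairs_mono G hHU subset_rfl
    rw [le_div_iff₀ hK0]
    refine le_of_mul_le_mul_right ?_ hd
    linarith
  set k := ⌈m / K⌉₊
  have hk : 0 < k := Nat.ceil_pos.2 (by positivity)
  have hk' : (0 : ℝ) < k := by exact_mod_cast hk
  have hmk : m / K ≤ k := Nat.le_ceil _
  have hk2 : (k : ℝ) ≤ 2 * (m / K) := by
    have := (Nat.ceil_lt_add_one (a := m / K) (by positivity)).le
    have : 1 ≤ m / K := by rwa [le_div_iff₀ hK0, one_mul]
    linarith
  set B := E * (4 / K) ^ (1 + c)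
  have hB : 0 ≤ B := by positivity
  have hsmall : ∀ P ⊆ U \ H, #P ≤ k → adjPairs G H H + 2 * adjPairs G H P ≤ B := by
    intro P hP hPk
    have hdisj : Disjoint H P := Finset.disjoint_sdiff.mono_right hP
    have hsplit := adjPairs_union_self G hdisj
    have hPP := adjPairs_nonneg G P P
    suffices adjPairs G (H ∪ P) (H ∪ P) ≤ B by linarith
    rcases (H ∪ P).eq_empty_or_nonempty with hemp | hne
    · rw [hemp]
      simpa [adjPairs] using hB
    · refine (hmax _ (Finset.union_subset hHU (hP.trans Finset.sdiff_subset)) hne).trans ?_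
      have hcard : (#(H ∪ P) : ℝ) ≤ #H + #P := by exact_mod_cast Finset.card_union_le _ _
      have hPk' : (#P : ℝ) ≤ k := by exact_mod_cast hPk
      have : (#(H ∪ P) : ℝ) / m ≤ 4 / K := by
        rw [div_le_iff₀ hm]
        calc (#(H ∪ P) : ℝ) ≤ 4 * (m / K) := by linarith
          _ = 4 / K * m := by ring
      simp only [B]
      gcongr
  have hHH : adjPairs G H H ≤ B := by
    have := hsmall ∅ (by simp) (by simp)
    rw [adjPairs_comm G H ∅] at this
    simpa [adjPairs] using this
  have hHL : 2 * adjPairs G H (U \ H) ≤ (K + 1) * B := by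
    have h := sum_le_of_small_subsets (fun v => 2 * adjPairs G {v} H) hk hB (U \ H) (by
      intro P hP hPk
      have := hsmall P hP hPk
      rw [← Finset.mul_sum, ← adjPairs_eq_sum_singleton, adjPairs_comm]
      linarith [adjPairs_nonneg G H H])
    rw [← Finset.mul_sum, ← adjPairs_eq_sum_singleton, adjPairs_comm] at h
    refine h.trans ?_
    gcongr
    rw [div_le_iff₀ hk']
    have h1 : (#(U \ H) : ℝ) ≤ m := Nat.cast_le.2 (Finset.card_le_card Finset.sdiff_subset)
    have h2 : m ≤ K * k := by
      rw [div_le_iff₀ hK0] at hmk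
      linarith
    linarith
  refine ⟨U \ H, Finset.sdiff_subset, ?_, fun v hv => ?_⟩
  · have hsplit := adjPairs_union_self G (Finset.disjoint_sdiff (s := H) (t := U))
    rw [Finset.union_sdiff_of_subset hHU] at hsplit
    have hBE : (K + 2) * B ≤ E / 2 := by
      have hpow : (4 / K) ^ (1 + c) = 4 / K * (4 ^ c / K ^ c) := by
        rw [Real.rpow_add (by positivity), Real.rpow_one, Real.div_rpow (by norm_num) hK0.le]
      have hKcpos : 0 < K ^ c := by positivity
      have hratio : 4 ^ c / K ^ c ≤ 1 / 24 := by
        rw [div_le_div_iff₀ hKcpos (by norm_num)]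
        linarith
      calc (K + 2) * B ≤ (3 * K) * (E * (4 / K * (1 / 24))) := by
            simp only [B, hpow]
            gcongr
            linarith
        _ = E / 2 := by field_simp; norm_num
    simp only [E] at *
    linarith
  · obtain ⟨hvU, hvH⟩ := Finset.mem_sdiff.1 hv
    refine (adjPairs_mono G subset_rfl Finset.sdiff_subset).trans ?_
    by_contra! hcon
    exact hvH (Finset.mem_filter.2 ⟨hvU, hcon⟩)

/-- Some vertex set maximises `adjPairs G U U / |U| ^ (1 + c)`. -/
lemma exists_maximal_density [Fintype V] [Nonempty V] (G : SimpleGraph V) (c : ℝ) :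
    ∃ U : Finset V, U.Nonempty ∧ ∀ W : Finset V, W.Nonempty →
      adjPairs G W W ≤ adjPairs G U U * ((#W : ℝ) / #U) ^ (1 + c) := by
  classical
  obtain ⟨U, hU, hmax⟩ := (univ.filter fun W : Finset V => W.Nonempty).exists_max_image
    (fun W => adjPairs G W W / (#W : ℝ) ^ (1 + c)) ⟨univ, by simp⟩
  have hU' : U.Nonempty := (Finset.mem_filter.1 hU).2
  refine ⟨U, hU', fun W hW => ?_⟩
  have hWpos : (0 : ℝ) < #W := by exact_mod_cast hW.card_pos
  have h := hmax W (by simpa using hW)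
  rw [div_le_iff₀ (by positivity)] at h
  rw [Real.div_rpow (by positivity) (by positivity)]
  exact h.trans_eq (by ring)

end Regularization

section Parameters

/-- The arithmetic behind sampling with probability `D ^ (ε - 1)`. -/
lemma two_mul_sampling_loss_le {ε D : ℝ} (hε : 0 < ε) (hD : 1 ≤ D)
    (hD80 : 80 ≤ D ^ (2 * ε)) :
    2 * ((2 * D) ^ (2 - 5 * ε) * ((D ^ (ε - 1)) ^ 3 * D + 4 * (D ^ (ε - 1)) ^ 2)) ≤ 1 / 2 := by
  have hD0 : 0 < D := by linarith
  have h3 : (D ^ (ε - 1)) ^ 3 * D = D ^ (3 * ε - 2) := by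
    rw [← Real.rpow_natCast, ← Real.rpow_mul hD0.le, ← Real.rpow_add_one hD0.ne']
    congr 1
    push_cast
    ring
  have h2 : (D ^ (ε - 1)) ^ 2 ≤ D ^ (3 * ε - 2) := by
    rw [← Real.rpow_natCast, ← Real.rpow_mul hD0.le]
    refine Real.rpow_le_rpow_of_exponent_le hD ?_
    push_cast
    linarith
  have hM : (2 * D) ^ (2 - 5 * ε) ≤ 4 * D ^ (2 - 5 * ε) := by
    rw [Real.mul_rpow (by norm_num) hD0.le]
    gcongr
    calc (2 : ℝ) ^ (2 - 5 * ε) ≤ 2 ^ (2 : ℝ) :=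
          Real.rpow_le_rpow_of_exponent_le (by norm_num) (by linarith)
      _ = 4 := by norm_num
  have hprod : D ^ (2 - 5 * ε) * D ^ (3 * ε - 2) * D ^ (2 * ε) = 1 := by
    rw [← Real.rpow_add hD0, ← Real.rpow_add hD0, ← Real.rpow_zero D]
    congr 1
    ring
  have hprod_nonneg : 0 ≤ D ^ (2 - 5 * ε) * D ^ (3 * ε - 2) := by positivity
  calc 2 * ((2 * D) ^ (2 - 5 * ε) * ((D ^ (ε - 1)) ^ 3 * D + 4 * (D ^ (ε - 1)) ^ 2))
      ≤ 2 * (4 * D ^ (2 - 5 * ε) * (D ^ (3 * ε - 2) + 4 * D ^ (3 * ε - 2))) := by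
        rw [h3]
        gcongr
    _ = 40 * (D ^ (2 - 5 * ε) * D ^ (3 * ε - 2)) := by ring
    _ ≤ 1 / 2 := by nlinarith

/-- If no induced subgraph on at least `n ^ (1 / 4)` vertices is dense, then every set of at most
`2 D` vertices spans few edges, provided that `D` is not too small. -/
lemma adjPairs_self_le_of_sparse {V : Type*} {G : SimpleGraph V} {ε n D : ℝ} (hε : ε < 1 / 10)
    (hn : 1 ≤ n) (hD : n ^ (3 / 8 : ℝ) ≤ D)
    (hsparse : ∀ s : Finset V, n ^ ((1 : ℝ) / 4) ≤ #s →
      avgDeg (G.induce (s : Set V)) < (#s : ℝ) ^ (1 - 5 * ε))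
    (W : Finset V) (hW : (#W : ℝ) ≤ 2 * D) :
    adjPairs G W W ≤ (2 * D) ^ (2 - 5 * ε) := by
  have hn0 : 0 < n := by linarith
  by_cases hcard : n ^ ((1 : ℝ) / 4) ≤ #W
  · have hpos : (0 : ℝ) < #W := lt_of_lt_of_le (by positivity) hcard
    have h := hsparse W hcard
    rw [avgDeg_induce, div_lt_iff₀ hpos] at h
    calc adjPairs G W W ≤ (#W : ℝ) ^ (1 - 5 * ε) * #W := h.le
      _ = (#W : ℝ) ^ (2 - 5 * ε) := by
          rw [← Real.rpow_add_one hpos.ne']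
          congr 1
          ring
      _ ≤ (2 * D) ^ (2 - 5 * ε) := Real.rpow_le_rpow hpos.le hW (by linarith)
  · push Not at hcard
    have hbase : 1 ≤ n ^ (3 / 8 : ℝ) := Real.one_le_rpow hn (by norm_num)
    calc adjPairs G W W ≤ #W * #W := adjPairs_le_mul G W W
      _ ≤ n ^ ((1 : ℝ) / 4) * n ^ ((1 : ℝ) / 4) := by gcongr
      _ = n ^ (1 / 2 : ℝ) := by
          rw [← Real.rpow_add hn0]
          norm_num
      _ ≤ n ^ ((3 / 8 : ℝ) * (2 - 5 * ε)) :=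
          Real.rpow_le_rpow_of_exponent_le hn (by linarith)
      _ = (n ^ (3 / 8 : ℝ)) ^ (2 - 5 * ε) := Real.rpow_mul hn0.le _ _
      _ ≤ (2 * D) ^ (2 - 5 * ε) :=
          Real.rpow_le_rpow (by positivity) (by linarith) (by linarith)

/-- A set of maximal density inherits average degree `n ^ (3 / 8) / 8` from the whole graph. -/
lemma le_average_of_maximal_density {n m E P : ℝ} (hn : 1 ≤ n) (hm : 1 ≤ m)
    (hP : n * √n / 8 ≤ P) (hPE : P ≤ E * (n / m) ^ (1 + 1 / 8 : ℝ)) :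
    n ^ (3 / 8 : ℝ) / 8 ≤ E / m := by
  have hn0 : 0 < n := by linarith
  have hm0 : 0 < m := by linarith
  have hnpow : 0 < n ^ (1 + 1 / 8 : ℝ) := by positivity
  have hsplit : n * √n = n ^ (3 / 8 : ℝ) * n ^ (1 + 1 / 8 : ℝ) := by
    rw [Real.sqrt_eq_rpow, ← Real.rpow_one_add' hn0.le (by norm_num), ← Real.rpow_add hn0]
    norm_num
  have hmpow : m ≤ m ^ (1 + 1 / 8 : ℝ) := Real.self_le_rpow_of_one_le hm (by norm_num)
  have h : n ^ (3 / 8 : ℝ) / 8 * n ^ (1 + 1 / 8 : ℝ) ≤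
      E / m ^ (1 + 1 / 8 : ℝ) * n ^ (1 + 1 / 8 : ℝ) := by
    calc n ^ (3 / 8 : ℝ) / 8 * n ^ (1 + 1 / 8 : ℝ) = n * √n / 8 := by rw [hsplit]; ring
      _ ≤ E * (n / m) ^ (1 + 1 / 8 : ℝ) := hP.trans hPE
      _ = E / m ^ (1 + 1 / 8 : ℝ) * n ^ (1 + 1 / 8 : ℝ) := by
          rw [Real.div_rpow hn0.le hm0.le]
          ring
  have h' := le_of_mul_le_mul_right h hnpow
  have hE : 0 ≤ E := by
    have h0 : 0 ≤ E / m ^ (1 + 1 / 8 : ℝ) := le_trans (by positivity) h'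
    rw [le_div_iff₀ (by positivity)] at h0
    linarith
  exact h'.trans (div_le_div_of_nonneg_left hE hm0 hmpow)

end Parameters

/-- For an `n`-vertex graph with no independent set of size `√n`
(`n` large): either a polynomially dense induced subgraph on at least `n^(1/4)` vertices,
or a `C₄`-free induced subgraph of average degree at least `n^(ε/100)`. -/
theorem stmt11 :
    ∀ ε : ℝ, 0 < ε → ε < 1 / 10 →
      ∃ n₀ : ℕ, ∀ (V : Type) [Fintype V] (G : SimpleGraph V),
        n₀ ≤ Fintype.card V →
        (¬ ∃ I : Finset V, (I.card : ℝ) ≥ Real.sqrt (Fintype.card V) ∧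
            IndepSet G (I : Set V)) →
        (∃ s : Finset V, (s.card : ℝ) ≥ (Fintype.card V : ℝ) ^ ((1 : ℝ) / 4) ∧
            avgDeg (G.induce (s : Set V)) ≥ (s.card : ℝ) ^ ((1 : ℝ) - 5 * ε)) ∨
        (∃ s : Finset V, C4Free (G.induce (s : Set V)) ∧
            avgDeg (G.induce (s : Set V)) ≥ (Fintype.card V : ℝ) ^ (ε / 100)) := by
  intro ε hε hε'
  have hlim := (tendsto_rpow_atTop (show 0 < ε / 100 by positivity)).comp
    (tendsto_natCast_atTop_atTop (R := ℝ))
  obtain ⟨n₀, hn₀⟩ := Filter.eventually_atTop.1 (hlim.eventually_ge_atTop (10 ^ 12))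
  refine ⟨n₀, fun V _ G hcard hind => or_iff_not_imp_left.2 fun hdense => ?_⟩
  have hK := hn₀ _ hcard
  simp only [Function.comp_apply] at hK
  push Not at hdense
  have hncard : Fintype.card V ≠ 0 := by
    intro h0
    rw [h0, Nat.cast_zero, Real.zero_rpow (by positivity)] at hK
    norm_num at hK
  have hn1 : (1 : ℝ) ≤ Fintype.card V := by exact_mod_cast Nat.one_le_iff_ne_zero.2 hncard
  have : Nonempty V := Fintype.card_pos_iff.1 (Nat.pos_of_ne_zero hncard)
  have hnbig : 16 < Fintype.card V := by
    have h : (Fintype.card V : ℝ) ^ (ε / 100) ≤ (Fintype.card V : ℝ) ^ (1 : ℝ) :=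
      Real.rpow_le_rpow_of_exponent_le hn1 (by linarith)
    rw [Real.rpow_one] at h
    have : (16 : ℝ) < Fintype.card V := by linarith
    exact_mod_cast this
  have hP := le_adjPairs_univ_of_no_indepSet G hnbig hind
  obtain ⟨U, hUne, hmax⟩ := exists_maximal_density G (1 / 8)
  have hPE := hmax univ univ_nonempty
  rw [Finset.card_univ] at hPE
  have hm1 : (1 : ℝ) ≤ #U := by exact_mod_cast hUne.card_pos
  have hd := le_average_of_maximal_density hn1 hm1 hP hPE
  have hEm := adjPairs_le_mul G U U
  generalize hnn : (Fintype.card V : ℝ) = n at *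
  generalize hKn : n ^ (ε / 100) = K at *
  have hn0 : 0 < n := by linarith
  have hm0 : (0 : ℝ) < #U := by linarith
  have hKpow : ∀ j : ℕ, K ^ j = n ^ (ε / 100 * j) := fun j => by
    rw [← hKn, Real.rpow_mul hn0.le, Real.rpow_natCast]
  have hnK : K ^ 2 ≤ n ^ (3 / 8 : ℝ) := by
    rw [hKpow]
    exact Real.rpow_le_rpow_of_exponent_le hn1 (by push_cast; linarith)
  set d := adjPairs G U U / #U with hd_def
  have hd0 : 0 < d := lt_of_lt_of_le (by positivity) hd
  have hdU : d ≤ #U := (div_le_iff₀ hm0).2 hEm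
  have hE : adjPairs G U U = d * #U := (div_mul_cancel₀ _ hm0.ne').symm
  obtain ⟨L, hLU, hEL, hdeg⟩ := exists_almost_regular_subset (G := G) (U := U) (c := 1 / 8)
    (K := K) (by norm_num) (by linarith) (by
      calc (24 : ℝ) * 4 ^ (1 / 8 : ℝ) = (24 ^ 8 * 4) ^ (1 / 8 : ℝ) := by
            rw [Real.mul_rpow (by norm_num) (by norm_num), ← Real.rpow_natCast,
              ← Real.rpow_mul (by norm_num)]
            norm_num
        _ ≤ K ^ (1 / 8 : ℝ) := Real.rpow_le_rpow (by norm_num) (by linarith) (by norm_num))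
    (by nlinarith) (hE ▸ mul_pos hd0 hm0) (fun W _ hW => hmax W hW)
  rw [← hd_def] at hdeg
  set D := K * d with hD_def
  have hDn : n ^ (3 / 8 : ℝ) ≤ D := by nlinarith
  have hD1 : 1 ≤ D := (Real.one_le_rpow hn1 (by norm_num)).trans hDn
  have hD0 : 0 < D := by linarith
  have hDε : K ^ 3 ≤ D ^ ε := by
    calc K ^ 3 ≤ n ^ ((3 / 8 : ℝ) * ε) := by
          rw [hKpow]
          exact Real.rpow_le_rpow_of_exponent_le hn1 (by push_cast; linarith)
      _ = (n ^ (3 / 8 : ℝ)) ^ ε := Real.rpow_mul hn0.le _ _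
      _ ≤ D ^ ε := Real.rpow_le_rpow (by positivity) hDn hε.le
  have hKcube : K ≤ K ^ 3 := le_self_pow₀ (by linarith) (by norm_num)
  have hD80 : 80 ≤ D ^ (2 * ε) := by
    rw [two_mul, Real.rpow_add hD0]
    nlinarith
  have hloss := two_mul_sampling_loss_le hε hD1 hD80
  set p := D ^ (ε - 1) with hp
  have hp0 : 0 < p := by positivity
  have hpd : K ^ 2 ≤ p * d := by
    have hpD : p * D = D ^ ε := by
      rw [hp, ← Real.rpow_add_one hD0.ne']
      congr 1
      ring
    have hKpos : 0 < K := by linarith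
    refine le_of_mul_le_mul_left ?_ hKpos
    calc K * K ^ 2 = K ^ 3 := by ring
      _ ≤ p * D := hpD ▸ hDε
      _ = K * (p * d) := by rw [hD_def]; ring
  refine exists_c4Free_of_sampling G L hp0.le
    (Real.rpow_le_one_of_one_le_of_nonpos hD1 (by linarith)) (by linarith) hdeg
    (fun W _ hW => adjPairs_self_le_of_sparse hε' hn1 hDn (fun s hs => hdense s hs) W hW) ?_
  have hLcard : (#L : ℝ) ≤ #U := by exact_mod_cast Finset.card_le_card hLU
  have hmain : K * #L < p * adjPairs G L L / 2 := by
    calc K * #L ≤ K * #U := by gcongr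
      _ < K ^ 2 / 4 * #U := mul_lt_mul_of_pos_right (by nlinarith) hm0
      _ ≤ p * d / 4 * #U := mul_le_mul_of_nonneg_right (by linarith) hm0.le
      _ = p * (d * #U) / 4 := by ring
      _ ≤ p * adjPairs G L L / 2 := by
          rw [hE] at hEL
          nlinarith
  have hEL0 := adjPairs_nonneg G L L
  calc 0 < p * (p * adjPairs G L L / 2 - K * #L) := mul_pos hp0 (sub_pos.2 hmain)
    _ = p ^ 2 * adjPairs G L L * (1 - 1 / 2) - K * (p * #L) := by ring
    _ ≤ p ^ 2 * adjPairs G L L *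
          (1 - 2 * ((2 * D) ^ (2 - 5 * ε) * (p ^ 3 * D + 4 * p ^ 2))) - K * (p * #L) := by
        gcongr
    _ = _ := by ring
end

section
/- Let k, s, d ≥ 1 be integers satisfying d ≥ (2(10+s))^s and d/20 > C(s+k, s) (the binomial coefficient 'choose'). Let G be a d-degenerate graph whose vertex set is partitioned as V(G) = A ∪ B with e(G[A,B]) ≥ d|A|/10 and |A| > 40·d^{s+2}·|B|. If the clique number of G satisfies ω(G) ≤ k, then G contains an induced subgraph which is the 1-subdivision of an s-uniform multihypergraph 𝓗 with average degree d(𝓗) ≥ d. -/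
open Finset

/-- A `d`-degenerate graph has an orientation with all out-degrees at most `d`. -/
lemma Degenerate.exists_orientation {V : Type*} [DecidableEq V] {G : SimpleGraph V} {d : ℕ}
    (hG : Degenerate G d) (X : Finset V) :
    ∃ out : V → Finset V, (∀ v, #(out v) ≤ d) ∧ (∀ u, ∀ v ∈ out u, G.Adj u v) ∧
      ∀ u ∈ X, ∀ v ∈ X, G.Adj u v → v ∈ out u ∨ u ∈ out v := by
  classical
  induction X using Finset.strongInduction with
  | H X ih =>
    rcases X.eq_empty_or_nonempty with rfl | hX
    · exact ⟨fun _ => ∅, by simp, by simp, by simp⟩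
    obtain ⟨w, hw, hdeg⟩ := hG X hX
    obtain ⟨out, hout, hsub, hadj⟩ := ih (X.erase w) (Finset.erase_ssubset hw)
    have hset : ((X : Set V) ∩ G.neighborSet w) = ↑(X.filter (G.Adj w)) := by
      ext v; simp
    rw [hset, Set.ncard_coe_finset] at hdeg
    refine ⟨Function.update out w (X.filter (G.Adj w)), fun v => ?_, fun u v huv => ?_,
      fun u hu v hv huv => ?_⟩
    · by_cases h : v = w
      · subst h; simpa using hdeg
      · simpa [h] using hout v
    · by_cases h : u = w
      · subst h
        rw [Function.update_self] at huv
        exact (Finset.mem_filter.1 huv).2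
      · rw [Function.update_of_ne h] at huv
        exact hsub u v huv
    · by_cases h : u = w
      · subst h; left; simp [hv, huv]
      by_cases h' : v = w
      · subst h'; right; simp [hu, huv.symm]
      simpa [h, h'] using
        hadj u (Finset.mem_erase.2 ⟨h, hu⟩) v (Finset.mem_erase.2 ⟨h', hv⟩) huv

/-- Every vertex set in a `d`-degenerate graph contains an independent set of at least a
`1 / (d + 1)` proportion of its vertices. -/
lemma Degenerate.exists_indepSet {V : Type*} [DecidableEq V] {G : SimpleGraph V} {d : ℕ}
    (hG : Degenerate G d) (X : Finset V) :
    ∃ I ⊆ X, IndepSet G (I : Set V) ∧ #X ≤ (d + 1) * #I := by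
  classical
  induction X using Finset.strongInduction with
  | H X ih =>
    rcases X.eq_empty_or_nonempty with rfl | hX
    · exact ⟨∅, by simp, by simp [IndepSet], by simp⟩
    obtain ⟨w, hw, hdeg⟩ := hG X hX
    have hset : ((X : Set V) ∩ G.neighborSet w) = ↑(X.filter (G.Adj w)) := by
      ext v; simp
    rw [hset, Set.ncard_coe_finset] at hdeg
    set R := insert w (X.filter (G.Adj w)) with hR
    have hRX : R ⊆ X := by
      rw [hR]
      exact Finset.insert_subset hw (Finset.filter_subset _ _)
    have hRcard : #R ≤ d + 1 := (Finset.card_insert_le _ _).trans (by omega)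
    obtain ⟨I, hIX, hI, hcard⟩ := ih (X \ R)
      (Finset.sdiff_ssubset hRX ⟨w, Finset.mem_insert_self _ _⟩)
    have hIR : ∀ v ∈ I, v ∈ X ∧ v ≠ w ∧ ¬ G.Adj w v := by
      intro v hv
      have := hIX hv
      simp only [hR, Finset.mem_sdiff, Finset.mem_insert, Finset.mem_filter] at this
      tauto
    have hwI : w ∉ I := fun h => (hIR w h).2.1 rfl
    refine ⟨insert w I, Finset.insert_subset hw fun v hv => (hIR v hv).1, ?_, ?_⟩
    · rw [Finset.coe_insert, IndepSet, Set.pairwise_insert]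
      exact ⟨hI, fun v hv _ => ⟨(hIR v hv).2.2, fun h => (hIR v hv).2.2 h.symm⟩⟩
    · rw [Finset.card_insert_of_notMem hwI]
      have := Finset.card_sdiff_add_card_eq_card hRX
      nlinarith

/-- Ramsey's theorem with the Erdős–Szekeres bound. -/
lemma exists_indepSet_or_clique {V : Type*} [DecidableEq V] (G : SimpleGraph V) (s k : ℕ)
    (X : Finset V) (hX : (s + k).choose s ≤ #X) :
    (∃ S ⊆ X, #S = s ∧ IndepSet G (S : Set V)) ∨ ∃ T ⊆ X, G.IsNClique (k + 1) T := by
  classical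
  induction s generalizing k X with
  | zero => exact Or.inl ⟨∅, by simp, by simp, by simp [IndepSet]⟩
  | succ s ihs =>
    induction k generalizing X with
    | zero =>
      simp only [add_zero, Nat.choose_self] at hX
      obtain ⟨v, hv⟩ := Finset.card_pos.1 hX
      exact Or.inr ⟨{v}, by simpa using hv, by simp [SimpleGraph.isNClique_iff]⟩
    | succ k ihk =>
      have hpascal : (s + 1 + (k + 1)).choose (s + 1) =
          (s + (k + 1)).choose s + (s + 1 + k).choose (s + 1) := by
        rw [show s + 1 + (k + 1) = (s + (k + 1)) + 1 by ring, Nat.choose_succ_succ,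
          show s + (k + 1) = s + 1 + k by ring]
      have hpos : 0 < #X := lt_of_lt_of_le (Nat.choose_pos (by omega)) hX
      obtain ⟨v, hv⟩ := Finset.card_pos.1 hpos
      have hsplit := Finset.card_filter_add_card_filter_not (s := X.erase v) (G.Adj v)
      rw [Finset.card_erase_of_mem hv] at hsplit
      by_cases hnon : (s + (k + 1)).choose s ≤ #((X.erase v).filter fun u => ¬ G.Adj v u)
      · rcases ihs (k + 1) _ hnon with ⟨S, hS, hcard, hind⟩ | ⟨T, hT, hclique⟩
        · have hSv : ∀ u ∈ S, u ≠ v ∧ u ∈ X ∧ ¬ G.Adj v u := by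
            intro u hu
            have := hS hu
            simp only [Finset.mem_filter, Finset.mem_erase] at this
            tauto
          refine Or.inl ⟨insert v S, Finset.insert_subset hv fun u hu => (hSv u hu).2.1, ?_, ?_⟩
          · rw [Finset.card_insert_of_notMem fun h => (hSv v h).1 rfl, hcard]
          · rw [Finset.coe_insert, IndepSet, Set.pairwise_insert]
            exact ⟨hind, fun u hu _ => ⟨(hSv u hu).2.2, fun h => (hSv u hu).2.2 h.symm⟩⟩
        · exact Or.inr ⟨T, hT.trans ((Finset.filter_subset _ _).trans (Finset.erase_subset _ _)),
            hclique⟩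
      · have hnbr : (s + 1 + k).choose (s + 1) ≤ #((X.erase v).filter (G.Adj v)) := by omega
        rcases ihk _ hnbr with ⟨S, hS, hcard, hind⟩ | ⟨T, hT, hclique⟩
        · exact Or.inl ⟨S, hS.trans ((Finset.filter_subset _ _).trans (Finset.erase_subset _ _)),
            hcard, hind⟩
        · have hTv : ∀ u ∈ T, u ∈ X ∧ G.Adj v u := by
            intro u hu
            have := hT hu
            simp only [Finset.mem_filter, Finset.mem_erase] at this
            tauto
          exact Or.inr ⟨insert v T, Finset.insert_subset hv fun u hu => (hTv u hu).1,
            hclique.insert fun u hu => (hTv u hu).2⟩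

/-- If every element of `B` is chosen independently with probability `p`, then all of `S` and
none of `T` is chosen with probability `p ^ #S * (1 - p) ^ #T`. -/
lemma sum_powerset_subset_disjoint {V : Type*} [DecidableEq V] {B S T : Finset V} (p : ℝ)
    (hS : S ⊆ B) (hT : T ⊆ B) (hST : Disjoint S T) :
    ∑ t ∈ B.powerset, (if S ⊆ t ∧ Disjoint T t then p ^ #t * (1 - p) ^ #(B \ t) else 0) =
      p ^ #S * (1 - p) ^ #T := by
  have hprod := Finset.prod_add (fun b => if b ∈ T then 0 else p)
    (fun b => if b ∈ S then 0 else 1 - p) B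
  have hval : ∏ b ∈ B, ((if b ∈ T then 0 else p) + (if b ∈ S then 0 else 1 - p)) =
      p ^ #S * (1 - p) ^ #T := by
    have hterm : ∀ b ∈ B, ((if b ∈ T then 0 else p) + (if b ∈ S then 0 else 1 - p)) =
        (if b ∈ S then p else 1) * (if b ∈ T then 1 - p else 1) := by
      intro b _
      by_cases h1 : b ∈ S
      · simp [h1, Finset.disjoint_left.1 hST h1]
      · by_cases h2 : b ∈ T <;> simp [h1, h2]
    rw [Finset.prod_congr rfl hterm, Finset.prod_mul_distrib, Finset.prod_ite_mem,
      Finset.prod_ite_mem, Finset.inter_eq_right.2 hS, Finset.inter_eq_right.2 hT]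
    simp
  rw [← hval, hprod]
  refine Finset.sum_congr rfl fun t ht => ?_
  rw [Finset.mem_powerset] at ht
  split_ifs with h
  · rw [Finset.prod_congr rfl (g := fun _ => p), Finset.prod_const,
      Finset.prod_congr rfl (g := fun _ => 1 - p), Finset.prod_const]
    · intro b hb
      rw [Finset.mem_sdiff] at hb
      exact if_neg fun hbS => hb.2 (h.1 hbS)
    · intro b hb
      exact if_neg fun hbT => Finset.disjoint_left.1 h.2 hbT hb
  · rw [not_and_or] at h
    symm
    rcases h with h | h
    · obtain ⟨b, hbS, hbt⟩ := Finset.not_subset.1 h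
      exact mul_eq_zero_of_right _
        (Finset.prod_eq_zero (Finset.mem_sdiff.2 ⟨hS hbS, hbt⟩) (if_pos hbS))
    · obtain ⟨b, hbT, hbt⟩ := Finset.not_disjoint_iff.1 h
      refine mul_eq_zero_of_left ?_ _
      exact Finset.prod_eq_zero hbt (if_pos hbT)

/-- First moment method: some `t ⊆ B` satisfies many of the requirements
`S a ⊆ t`, `Disjoint (T a) t` relative to its size. -/
lemma exists_subset_of_expectation {V : Type*} [DecidableEq V] {B I : Finset V}
    {S T : V → Finset V} {s N d : ℕ} {p : ℝ} (hp : 0 ≤ p) (hp1 : p ≤ 1)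
    (hS : ∀ a ∈ I, S a ⊆ B ∧ #(S a) = s)
    (hT : ∀ a ∈ I, T a ⊆ B ∧ #(T a) ≤ N ∧ Disjoint (S a) (T a))
    (hlarge : (d : ℝ) * (p * #B) < s * (#I * (p ^ s * (1 - p) ^ N))) :
    ∃ t ⊆ B, d * #t < s * #{a ∈ I | S a ⊆ t ∧ Disjoint (T a) t} := by
  by_contra! hcon
  let w : Finset V → ℝ := fun t => p ^ #t * (1 - p) ^ #(B \ t)
  have hw : ∀ t, 0 ≤ w t := fun t =>
    mul_nonneg (pow_nonneg hp _) (pow_nonneg (sub_nonneg.2 hp1) _)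
  have hgood : (#I * (p ^ s * (1 - p) ^ N) : ℝ) ≤
      ∑ t ∈ B.powerset, w t * #{a ∈ I | S a ⊆ t ∧ Disjoint (T a) t} := by
    have hswap : ∑ t ∈ B.powerset, w t * #{a ∈ I | S a ⊆ t ∧ Disjoint (T a) t} =
        ∑ a ∈ I, p ^ #(S a) * (1 - p) ^ #(T a) := by
      calc _ = ∑ t ∈ B.powerset, ∑ a ∈ I,
            (if S a ⊆ t ∧ Disjoint (T a) t then w t else 0) := by
            refine Finset.sum_congr rfl fun t _ => ?_
            rw [← Finset.sum_filter, Finset.sum_const, nsmul_eq_mul, mul_comm]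
        _ = _ := by
            rw [Finset.sum_comm]
            exact Finset.sum_congr rfl fun a ha =>
              sum_powerset_subset_disjoint p (hS a ha).1 (hT a ha).1 (hT a ha).2.2
    rw [hswap, ← nsmul_eq_mul]
    refine Finset.card_nsmul_le_sum _ _ _ fun a ha => ?_
    rw [(hS a ha).2]
    exact mul_le_mul_of_nonneg_left
      (pow_le_pow_of_le_one (sub_nonneg.2 hp1) (by linarith) (hT a ha).2.1) (pow_nonneg hp _)
  have hsize : ∑ t ∈ B.powerset, w t * #t = p * #B := by
    calc _ = ∑ t ∈ B.powerset, ∑ b ∈ B,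
          (if {b} ⊆ t ∧ Disjoint ∅ t then w t else 0) := by
          refine Finset.sum_congr rfl fun t ht => ?_
          rw [← Finset.sum_filter, Finset.sum_const, nsmul_eq_mul, mul_comm]
          congr 3
          ext b
          simpa using fun hb => Finset.mem_powerset.1 ht hb
      _ = ∑ b ∈ B, p := by
          rw [Finset.sum_comm]
          refine Finset.sum_congr rfl fun b hb => ?_
          simpa using sum_powerset_subset_disjoint (B := B) (S := {b}) (T := ∅) p
            (by simpa using hb) (by simp) (by simp)
      _ = _ := by simp [mul_comm]
  have hle : (s : ℝ) * ∑ t ∈ B.powerset, w t * #{a ∈ I | S a ⊆ t ∧ Disjoint (T a) t} ≤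
      d * ∑ t ∈ B.powerset, w t * #t := by
    rw [Finset.mul_sum, Finset.mul_sum]
    refine Finset.sum_le_sum fun t ht => ?_
    have h : ((s * #{a ∈ I | S a ⊆ t ∧ Disjoint (T a) t} : ℕ) : ℝ) ≤ (d * #t : ℕ) :=
      Nat.cast_le.2 (hcon t (Finset.mem_powerset.1 ht))
    push_cast at h
    nlinarith [mul_le_mul_of_nonneg_left h (hw t)]
  rw [hsize] at hle
  have := mul_le_mul_of_nonneg_left hgood (Nat.cast_nonneg (α := ℝ) s)
  linarith

/-- Two disjoint independent sets `X`, `Y` such that every vertex of `X` has exactly `s` neighbours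
in `Y` induce the 1-subdivision of an `s`-uniform multihypergraph. -/
lemma exists_oneSubdivision_embedding {V : Type*} [DecidableEq V] {G : SimpleGraph V}
    [DecidableRel G.Adj] {X Y : Finset V} {s : ℕ} (hXY : Disjoint X Y)
    (hX : IndepSet G (X : Set V)) (hY : IndepSet G (Y : Set V))
    (hdeg : ∀ x ∈ X, #{y ∈ Y | G.Adj x y} = s) :
    ∃ edges : Fin #X → Finset (Fin #Y), (∀ e, #(edges e) = s) ∧
      Nonempty (oneSubdivision edges ↪g G) := by
  let f : Fin #X ≃ X := X.equivFin.symm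
  let g : Fin #Y ≃ Y := Y.equivFin.symm
  have hdisj : ∀ i j, (f i : V) ≠ g j := fun i j h =>
    Finset.disjoint_left.1 hXY (f i).2 (h ▸ (g j).2)
  have hindX : ∀ i j, ¬ G.Adj (f i) (f j) := fun i j h => hX (f i).2 (f j).2 h.ne h
  have hindY : ∀ i j, ¬ G.Adj (g i) (g j) := fun i j h => hY (g i).2 (g j).2 h.ne h
  refine ⟨fun i => {j | G.Adj (f i) (g j)}, fun i => ?_, ⟨⟨⟨Sum.elim (fun i => (f i : V))
    (fun j => (g j : V)), ?_⟩, ?_⟩⟩⟩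
  · rw [← hdeg _ (f i).2]
    refine Finset.card_bij (fun j _ => (g j : V)) ?_ ?_ ?_
    · intro j hj
      simpa using hj
    · intro j _ j' _ h
      exact g.injective (Subtype.ext h)
    · intro y hy
      rw [Finset.mem_filter] at hy
      exact ⟨g.symm ⟨y, hy.1⟩, by simpa using hy.2, by simp⟩
  · rintro (i | i) (j | j) h
    · exact congrArg Sum.inl (f.injective (Subtype.ext h))
    · exact absurd h (hdisj i j)
    · exact absurd h.symm (hdisj j i)
    · exact congrArg Sum.inr (g.injective (Subtype.ext h))
  · rintro (i | i) (j | j)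
    · change G.Adj (f i) (f j) ↔ _
      simp [oneSubdivision, hindX]
    · change G.Adj (f i) (g j) ↔ _
      simp [oneSubdivision]
    · change G.Adj (g i) (f j) ↔ _
      simp [oneSubdivision, G.adj_comm]
    · change G.Adj (g i) (g j) ↔ _
      simp [oneSubdivision, hindY]

/-- A graph oriented with out-degrees at most `d` has at most `d * (#H + #B)` edges between
`H` and `B`. -/
lemma sum_card_adj_le {V : Type*} [DecidableEq V] {G : SimpleGraph V} [DecidableRel G.Adj]
    {d : ℕ} {out : V → Finset V} (hout : ∀ v, #(out v) ≤ d) {H B : Finset V}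
    (hadj : ∀ u ∈ H, ∀ v ∈ B, G.Adj u v → v ∈ out u ∨ u ∈ out v) :
    ∑ a ∈ H, #{b ∈ B | G.Adj a b} ≤ d * (#H + #B) := by
  have hcover : ∀ a ∈ H,
      #{b ∈ B | G.Adj a b} ≤ #(out a) + #{b ∈ B | a ∈ out b} := by
    intro a ha
    refine (Finset.card_le_card fun b hb => ?_).trans (Finset.card_union_le _ _)
    rw [Finset.mem_filter] at hb
    rw [Finset.mem_union, Finset.mem_filter]
    exact (hadj a ha b hb.1 hb.2).imp_right fun h => ⟨hb.1, h⟩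
  have hdouble : ∑ a ∈ H, #{b ∈ B | a ∈ out b} = ∑ b ∈ B, #{a ∈ H | a ∈ out b} :=
    Finset.sum_card_bipartiteAbove_eq_sum_card_bipartiteBelow fun a b => a ∈ out b
  calc _ ≤ ∑ a ∈ H, #(out a) + ∑ b ∈ B, #{a ∈ H | a ∈ out b} := by
        rw [← hdouble, ← Finset.sum_add_distrib]
        exact Finset.sum_le_sum hcover
    _ ≤ #H * d + #B * d := by
        refine add_le_add (Finset.sum_le_card_nsmul _ _ _ fun a _ => hout a)
          (Finset.sum_le_card_nsmul _ _ _ fun b _ => (Finset.card_le_card fun a ha => ?_).trans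
            (hout b))
        exact (Finset.mem_filter.1 ha).2
    _ = _ := by ring

lemma crossEdges_eq_sum {V : Type*} (G : SimpleGraph V) [DecidableRel G.Adj]
    (A B : Finset V) :
    crossEdges G (A : Set V) (B : Set V) = ∑ a ∈ A, #{b ∈ B | G.Adj a b} := by
  have hset : {p : V × V | p.1 ∈ (A : Set V) ∧ p.2 ∈ (B : Set V) ∧ G.Adj p.1 p.2} =
      ↑((A ×ˢ B).filter fun p => G.Adj p.1 p.2) := by
    ext p
    simp [and_assoc]
  rw [crossEdges, hset, Set.ncard_coe_finset, Finset.card_filter, Finset.sum_product]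
  simp only [Finset.card_filter]

/-- Most of the edges between `A` and `B` leave vertices of `A` of moderate degree. -/
lemma card_le_card_moderate_degree {V : Type*} [DecidableEq V] {G : SimpleGraph V}
    [DecidableRel G.Adj] {d c : ℕ} (hd : 1 ≤ d) (hc : 20 * c ≤ d) {out : V → Finset V}
    (hout : ∀ v, #(out v) ≤ d) {A B : Finset V}
    (hadj : ∀ u ∈ A, ∀ v ∈ B, G.Adj u v → v ∈ out u ∨ u ∈ out v)
    (hedges : d * #A ≤ 10 * ∑ a ∈ A, #{b ∈ B | G.Adj a b}) :
    #A ≤ 20 * #{a ∈ A | c ≤ #{b ∈ B | G.Adj a b} ∧ #{b ∈ B | G.Adj a b} ≤ 10 * d}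
      + 60 * #B := by
  set δ : V → ℕ := fun a => #{b ∈ B | G.Adj a b} with hδ
  have hsub : ∀ H ⊆ A, ∑ a ∈ H, δ a ≤ d * (#H + #B) := fun H hH =>
    sum_card_adj_le hout fun u hu => hadj u (hH hu)
  set M := A.filter fun a => c ≤ δ a ∧ δ a ≤ 10 * d with hM
  set H := A.filter fun a => 10 * d < δ a with hH
  have hMsum := hsub M (Finset.filter_subset _ _)
  have hHsum := hsub H (Finset.filter_subset _ _)
  have hHlow : #H * (10 * d) ≤ ∑ a ∈ H, δ a :=
    Finset.card_nsmul_le_sum _ _ _ fun a ha => (Finset.mem_filter.1 ha).2.le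
  have hHcard : #H ≤ #B := by
    by_contra! h
    nlinarith
  have hsplit : ∑ a ∈ A, δ a ≤ #A * c + (∑ a ∈ M, δ a + ∑ a ∈ H, δ a) := by
    rw [hM, hH, Finset.sum_filter, Finset.sum_filter, ← smul_eq_mul, ← Finset.sum_const,
      ← Finset.sum_add_distrib, ← Finset.sum_add_distrib]
    refine Finset.sum_le_sum fun a _ => ?_
    split_ifs <;> omega
  have hAc : 20 * (#A * c) ≤ d * #A := by nlinarith
  have hHB : d * #H ≤ d * #B := Nat.mul_le_mul_left _ hHcard
  have : d * #A ≤ d * (20 * #M + 60 * #B) := by nlinarith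
  exact Nat.le_of_mul_le_mul_left this hd

/-- The numerical inequality behind the first moment computation, with
`p = 1 / (2 * (10 + s) * d)`. -/
lemma expectation_bound {s d i b : ℕ} (hs : 1 ≤ s) (hd1 : 1 ≤ d)
    (hd : ((2 * (10 + s)) : ℝ) ^ s ≤ d) (hi : 0 < i) (hib : d ^ (s + 1) * b ≤ 2 * i) :
    (d : ℝ) * (1 / (2 * (10 + s) * d) * b) <
      s * (i * ((1 / (2 * (10 + s) * d)) ^ s *
        (1 - 1 / (2 * (10 + s) * d)) ^ ((10 + s) * d))) := by
  have hd0 : (1 : ℝ) ≤ d := by exact_mod_cast hd1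
  have hs0 : (1 : ℝ) ≤ s := by exact_mod_cast hs
  have hi0 : (0 : ℝ) < i := by exact_mod_cast hi
  have hib' : (d : ℝ) ^ (s + 1) * b ≤ 2 * i := by exact_mod_cast hib
  set N : ℝ := 2 * (10 + s) with hN
  have hN22 : 22 ≤ N := by linarith
  have hNd : 0 < N * d := by positivity
  have hp1 : 1 / (N * d) ≤ 1 := by
    rw [div_le_one hNd]; nlinarith
  have hbern : (1 / 2 : ℝ) ≤ (1 - 1 / (N * d)) ^ ((10 + s) * d) := by
    have h := one_add_mul_le_pow (a := -(1 / (N * d))) (by linarith) ((10 + s) * d)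
    have heq : (((10 + s) * d : ℕ) : ℝ) * (-(1 / (N * d))) = -(1 / 2) := by
      push_cast
      rw [hN]
      field_simp
    rw [heq] at h
    rw [sub_eq_add_neg]
    linarith
  have hpow : 1 / (d : ℝ) ^ (s + 1) ≤ (1 / (N * d)) ^ s := by
    rw [div_pow, one_pow, mul_pow]
    refine one_div_le_one_div_of_le (by positivity) ?_
    rw [pow_succ, mul_comm]
    exact mul_le_mul_of_nonneg_left hd (by positivity)
  have hb : (b : ℝ) ≤ 2 * i / (d : ℝ) ^ (s + 1) := by
    rw [le_div_iff₀ (by positivity)]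
    linarith
  have hq : 0 < (i : ℝ) / (d : ℝ) ^ (s + 1) := by positivity
  calc (d : ℝ) * (1 / (N * d) * b) = b / N := by field_simp
    _ ≤ b / 22 := div_le_div_of_nonneg_left (by positivity) (by norm_num) hN22
    _ ≤ (2 * i / (d : ℝ) ^ (s + 1)) / 22 := by gcongr
    _ < 1 * (i * (1 / (d : ℝ) ^ (s + 1) * (1 / 2))) := by
        have h1 : (2 * i / (d : ℝ) ^ (s + 1)) / 22 = (i / (d : ℝ) ^ (s + 1)) / 11 := by ring
        have h2 : 1 * (i * (1 / (d : ℝ) ^ (s + 1) * (1 / 2))) =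
          (i / (d : ℝ) ^ (s + 1)) / 2 := by ring
        rw [h1, h2]
        linarith
    _ ≤ _ := by gcongr

/-- Unbalanced case: a `d`-degenerate graph with clique number at most
`k` and a heavily unbalanced bipartition `A ∪ B` carrying many edges contains an induced
1-subdivision of an `s`-uniform multihypergraph of average degree at least `d`. -/
theorem stmt14 :
    ∀ k s d : ℕ, 1 ≤ k → 1 ≤ s → 1 ≤ d →
      (d : ℝ) ≥ ((2 * (10 + s)) : ℝ) ^ s →
      (d : ℝ) / 20 > ((s + k).choose s : ℝ) →
      ∀ (V : Type) [Fintype V] [DecidableEq V] (G : SimpleGraph V) (A B : Finset V),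
        Degenerate G d → Disjoint A B → A ∪ B = Finset.univ →
        (crossEdges G (A : Set V) (B : Set V) : ℝ) ≥ (d : ℝ) * (A.card : ℝ) / 10 →
        (A.card : ℝ) > 40 * (d : ℝ) ^ (s + 2) * (B.card : ℝ) →
        G.cliqueNum ≤ k →
        ∃ (m n : ℕ) (edges : Fin m → Finset (Fin n)),
          (∀ e, (edges e).card = s) ∧
          ((s : ℝ) * m / n ≥ (d : ℝ)) ∧
          Nonempty (oneSubdivision edges ↪g G) := by
  intro k s d _ hs hd hds hdk V _ _ G A B hG hAB _ hcross hA hclique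
  classical
  obtain ⟨out, hout, houtadj, hadj⟩ := hG.exists_orientation Finset.univ
  have hadj' : ∀ u v, G.Adj u v → v ∈ out u ∨ u ∈ out v := fun u v =>
    hadj u (Finset.mem_univ _) v (Finset.mem_univ _)
  have hc : 20 * (s + k).choose s ≤ d := by
    have : (20 * (s + k).choose s : ℝ) ≤ d := by linarith
    exact_mod_cast this
  have hedges : d * #A ≤ 10 * ∑ a ∈ A, #{b ∈ B | G.Adj a b} := by
    rw [← crossEdges_eq_sum]
    have : (d * #A : ℝ) ≤ 10 * crossEdges G (A : Set V) (B : Set V) := by linarith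
    exact_mod_cast this
  have hmod := card_le_card_moderate_degree hd hc hout (fun u _ v _ => hadj' u v) hedges
  set M := A.filter fun a => (s + k).choose s ≤ #{b ∈ B | G.Adj a b} ∧
    #{b ∈ B | G.Adj a b} ≤ 10 * d with hM
  obtain ⟨I, hIM, hI, hIcard⟩ := hG.exists_indepSet M
  have hA' : 40 * d ^ (s + 2) * #B < #A := by exact_mod_cast hA
  have hd3 : 3 ≤ d := by
    have := Nat.choose_pos (n := s + k) (k := s) (by omega)
    omega
  have hdpow : 3 ≤ d ^ (s + 2) := hd3.trans (Nat.le_self_pow (by omega) d)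
  have hMB : d ^ (s + 2) * #B < #M := by nlinarith
  have hIpos : 0 < #I := by
    by_contra! h
    have : #I = 0 := by omega
    rw [this] at hIcard
    omega
  have hIB : d ^ (s + 1) * #B ≤ 2 * #I := by
    refine Nat.le_of_mul_le_mul_left (c := d) ?_ hd
    have : d * (d ^ (s + 1) * #B) = d ^ (s + 2) * #B := by ring
    rw [this]
    nlinarith
  have hramsey : ∀ a ∈ I, ∃ S ⊆ B.filter (G.Adj a), #S = s ∧ IndepSet G (S : Set V) := by
    intro a ha
    rcases exists_indepSet_or_clique G s k _ (Finset.mem_filter.1 (hIM ha)).2.1 with h | h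
    · exact h
    · obtain ⟨T, -, hT⟩ := h
      have := hT.isClique.card_le_cliqueNum
      rw [hT.card_eq] at this
      omega
  choose! S hSsub hScard hSind using hramsey
  let T : V → Finset V := fun a => (B.filter (G.Adj a) \ S a) ∪ ((S a).biUnion out ∩ B) \ S a
  let p : ℝ := 1 / (2 * (10 + s) * d)
  have hp1 : p ≤ 1 := by
    have h1 : (1 : ℝ) ≤ d := by exact_mod_cast hd
    have h2 : (0 : ℝ) ≤ s := Nat.cast_nonneg s
    exact (div_le_one (by positivity)).2 (by nlinarith)
  obtain ⟨t, htB, ht⟩ := exists_subset_of_expectation (S := S) (T := T) (I := I) (B := B) (s := s)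
    (N := (10 + s) * d) (d := d) (p := p) (by positivity) hp1
    (fun a ha => ⟨(hSsub a ha).trans (Finset.filter_subset _ _), hScard a ha⟩)
    (fun a ha => by
      refine ⟨?_, ?_, ?_⟩
      · exact Finset.union_subset (Finset.sdiff_subset.trans (Finset.filter_subset _ _))
          (Finset.sdiff_subset.trans Finset.inter_subset_right)
      · calc #(T a) ≤ #(B.filter (G.Adj a)) + #((S a).biUnion out) :=
              (Finset.card_union_le _ _).trans (add_le_add
                (Finset.card_le_card Finset.sdiff_subset)
                (Finset.card_le_card (Finset.sdiff_subset.trans Finset.inter_subset_left)))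
          _ ≤ 10 * d + #(S a) * d := add_le_add (Finset.mem_filter.1 (hIM ha)).2.2
              (Finset.card_biUnion_le_card_mul _ _ _ fun v _ => hout v)
          _ = (10 + s) * d := by rw [hScard a ha]; ring
      · exact Finset.disjoint_union_right.2 ⟨Finset.disjoint_sdiff, Finset.disjoint_sdiff⟩)
    (expectation_bound hs hd hds hIpos hIB)
  set Y := t.filter fun b => ∀ c ∈ t, c ∉ out b with hYdef
  set X := I.filter fun a => S a ⊆ t ∧ Disjoint (T a) t with hXdef
  have hYt : Y ⊆ t := Finset.filter_subset _ _
  have hXI : X ⊆ I := Finset.filter_subset _ _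
  have hXY : Disjoint X Y := hAB.mono (hXI.trans (hIM.trans (Finset.filter_subset _ _)))
    (hYt.trans htB)
  have hYind : IndepSet G (Y : Set V) := by
    intro u hu v hv _ huv
    rw [Finset.mem_coe, hYdef, Finset.mem_filter] at hu hv
    rcases hadj' u v huv with h | h
    · exact hu.2 v hv.1 h
    · exact hv.2 u hu.1 h
  have hnbr : ∀ a ∈ X, Y.filter (G.Adj a) = S a := by
    intro a ha
    obtain ⟨haI, hSt, hTt⟩ := Finset.mem_filter.1 ha
    ext b
    rw [Finset.mem_filter]
    constructor
    · rintro ⟨hbY, hab⟩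
      by_contra hbS
      refine Finset.disjoint_left.1 hTt (Finset.mem_union_left _ ?_) (hYt hbY)
      exact Finset.mem_sdiff.2 ⟨Finset.mem_filter.2 ⟨htB (hYt hbY), hab⟩, hbS⟩
    · intro hbS
      refine ⟨Finset.mem_filter.2 ⟨hSt hbS, fun c hct hcb => ?_⟩,
        (Finset.mem_filter.1 (hSsub a haI hbS)).2⟩
      by_cases hcS : c ∈ S a
      · exact hSind a haI hbS hcS (houtadj b c hcb).ne (houtadj b c hcb)
      · refine Finset.disjoint_left.1 hTt (Finset.mem_union_right _ ?_) hct
        exact Finset.mem_sdiff.2 ⟨Finset.mem_inter.2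
          ⟨Finset.mem_biUnion.2 ⟨b, hbS, hcb⟩, htB hct⟩, hcS⟩
  obtain ⟨edges, hcard, hemb⟩ := exists_oneSubdivision_embedding hXY
    (hI.mono (Finset.coe_subset.2 hXI)) hYind
    (fun a ha => by rw [hnbr a ha]; exact hScard a (hXI ha))
  refine ⟨#X, #Y, edges, hcard, ?_, hemb⟩
  have hXpos : 0 < #X := by
    by_contra! h
    have : #X = 0 := by omega
    rw [this] at ht
    omega
  obtain ⟨a, ha⟩ := Finset.card_pos.1 hXpos
  have hYpos : 0 < #Y := by
    refine lt_of_lt_of_le ?_ (Finset.card_le_card (Finset.filter_subset (G.Adj a) Y))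
    rw [hnbr a ha, hScard a (hXI ha)]
    exact hs
  rw [ge_iff_le, le_div_iff₀ (by exact_mod_cast hYpos)]
  have : d * #Y ≤ s * #X := (Nat.mul_le_mul_left d (Finset.card_le_card hYt)).trans ht.le
  exact_mod_cast this
end

section
/- Let r ≥ k ≥ 2 and n ≥ 10r² be integers, and suppose 𝓕 ⊆ 𝒫([n]) is a family of subsets of [n] = {1, …, n} with the properties that (i) for every k-element subset S ⊆ [n] there exists F ∈ 𝓕 with S ⊆ F, and (ii) |F| ≤ n/r^{k+1} for every F ∈ 𝓕. Then there exists an r-element subset R ⊆ [n] which is k-shattered by 𝓕, i.e. for every k-element subset S ⊆ R there exists F ∈ 𝓕 with R ∩ F = S. -/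
open Finset

/-- The number of `r`-sets containing a fixed set `T` is at most `C(n - |T|, r - |T|)`. -/
lemma card_filter_superset_powersetCard_le {α : Type*} [Fintype α] [DecidableEq α]
    (T : Finset α) (r : ℕ) :
    #{R ∈ powersetCard r (univ : Finset α) | T ⊆ R} ≤
      (Fintype.card α - #T).choose (r - #T) := by
  rw [← card_compl, ← card_powersetCard]
  refine card_le_card_of_injOn (fun R => R \ T) ?_ ?_
  · intro R hR
    simp only [coe_filter, mem_powersetCard, Set.mem_ofPred_eq, subset_univ, true_and] at hR
    simp only [mem_coe, mem_powersetCard]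
    refine ⟨fun x hx => by simpa using (mem_sdiff.1 hx).2, ?_⟩
    rw [card_sdiff_of_subset hR.2, hR.1]
  · intro R hR R' hR' h
    simp only [coe_filter, Set.mem_ofPred_eq] at hR hR'
    rw [← sdiff_union_of_subset hR.2, ← sdiff_union_of_subset hR'.2]
    exact congrArg (· ∪ T) h

/-- If every `r`-set contains a `k`-set `S` together with a point of `A S \ S`, where
always `|A S \ S| ≤ b`, then the number of `r`-sets is at most `C(n, k) * b * C(n-k-1, r-k-1)`. -/
lemma choose_le_of_forall_exists_mem_sdiff {α : Type*} [Fintype α] [DecidableEq α]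
    (r k b : ℕ) (A : Finset α → Finset α)
    (hb : ∀ S : Finset α, #S = k → #(A S \ S) ≤ b)
    (hbad : ∀ R : Finset α, #R = r → ∃ S ⊆ R, #S = k ∧ ∃ v ∈ A S \ S, v ∈ R) :
    (Fintype.card α).choose r ≤
      (Fintype.card α).choose k * (b * (Fintype.card α - (k + 1)).choose (r - (k + 1))) := by
  rw [← card_univ, ← card_powersetCard r, ← card_powersetCard k, card_univ]
  have hcover : powersetCard r (univ : Finset α) ⊆
      (powersetCard k univ).biUnion fun S => (A S \ S).biUnion fun v =>
        {R ∈ powersetCard r (univ : Finset α) | insert v S ⊆ R} := by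
    intro R hR
    obtain ⟨S, hSR, hS, v, hv, hvR⟩ := hbad R (mem_powersetCard.1 hR).2
    simp only [mem_biUnion, mem_filter]
    exact ⟨S, mem_powersetCard.2 ⟨subset_univ _, hS⟩, v, hv, hR, insert_subset hvR hSR⟩
  refine (card_le_card hcover).trans (card_biUnion_le_card_mul _ _ _ fun S hS => ?_)
  have hS' := (mem_powersetCard.1 hS).2
  refine (card_biUnion_le_card_mul _ _ ((Fintype.card α - (k + 1)).choose (r - (k + 1)))
    fun v hv => ?_).trans (Nat.mul_le_mul_right _ (hb S hS'))
  have := card_filter_superset_powersetCard_le (insert v S) r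
  rwa [card_insert_of_notMem (mem_sdiff.1 hv).2, hS'] at this

/-- The binomial estimate behind the union bound over pairs `(S, v)`. -/
lemma choose_mul_lt_choose {n r k b : ℕ} (hk : 1 ≤ k) (hkr : k < r) (hrn : r ≤ n)
    (hb : (b + k) * r ^ (k + 1) ≤ n) :
    n.choose k * (b * (n - (k + 1)).choose (r - (k + 1))) < n.choose r := by
  obtain ⟨q, rfl⟩ := Nat.exists_eq_add_of_lt hkr
  obtain ⟨p, rfl⟩ := Nat.exists_eq_add_of_le hrn
  set r := k + q + 1 with hr
  set n := r + p with hn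
  have e1 : n - (k + 1) = q + p := by omega
  have e2 : r - (k + 1) = q := by omega
  rw [e1, e2]
  have h1 : n.choose r * r.choose k = n.choose k * (q + p + 1).choose (q + 1) := by
    have := Nat.choose_mul (n := n) hkr.le
    rwa [show n - k = q + p + 1 by omega, show r - k = q + 1 by omega] at this
  have h2 := Nat.add_one_mul_choose_eq (q + p) q
  have hpos : 0 < (q + p).choose q := Nat.choose_pos (by omega)
  have hpos' : 0 < n.choose k := Nat.choose_pos (by omega)
  have hrk : r.choose k * (q + 1) ≤ r ^ (k + 1) := by
    rw [pow_succ]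
    exact Nat.mul_le_mul (Nat.choose_le_pow r k) (by omega)
  have hr1 : 1 < r ^ (k + 1) := Nat.one_lt_pow (by omega) (by omega)
  have hlt : b * (r.choose k * (q + 1)) < q + p + 1 := by
    have h3 : b * (r.choose k * (q + 1)) ≤ b * r ^ (k + 1) := Nat.mul_le_mul_left _ hrk
    have h4 : k < k * r ^ (k + 1) := lt_mul_of_one_lt_right (by omega) hr1
    rw [add_mul] at hb
    omega
  refine lt_of_mul_lt_mul_right (a := r.choose k * (q + 1)) ?_ (Nat.zero_le _)
  calc n.choose k * (b * (q + p).choose q) * (r.choose k * (q + 1))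
      = n.choose k * (q + p).choose q * (b * (r.choose k * (q + 1))) := by ring
    _ < n.choose k * (q + p).choose q * (q + p + 1) :=
        Nat.mul_lt_mul_of_pos_left hlt (Nat.mul_pos hpos' hpos)
    _ = n.choose k * ((q + p + 1) * (q + p).choose q) := by ring
    _ = n.choose r * r.choose k * (q + 1) := by rw [h2, h1]; ring
    _ = n.choose r * (r.choose k * (q + 1)) := by ring

/-- Shattering: if every `k`-subset of `[n]` is covered by a member of
`𝓕` and every member has size at most `n / r^(k+1)` (with `r ≥ k ≥ 2`, `n ≥ 10r²`),
then some `r`-subset of `[n]` is `k`-shattered by `𝓕`. -/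
theorem stmt18 :
    ∀ r k n : ℕ, 2 ≤ k → k ≤ r → 10 * r ^ 2 ≤ n →
      ∀ 𝓕 : Set (Finset (Fin n)),
        (∀ S : Finset (Fin n), S.card = k → ∃ A ∈ 𝓕, S ⊆ A) →
        (∀ A ∈ 𝓕, (A.card : ℝ) ≤ (n : ℝ) / (r : ℝ) ^ (k + 1)) →
        ∃ R : Finset (Fin n), R.card = r ∧
          ∀ S : Finset (Fin n), S ⊆ R → S.card = k → ∃ A ∈ 𝓕, R ∩ A = S := by
  classical
  intro r k n hk hkr hn 𝓕 hcover hsmall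
  have hrn : r ≤ n := by nlinarith
  have hrpos : 0 < r ^ (k + 1) := Nat.pow_pos (by omega)
  rcases hkr.eq_or_lt with rfl | hkr
  · obtain ⟨R, hR⟩ := exists_subset_card_eq (s := (univ : Finset (Fin n))) (n := k) (by simpa)
    refine ⟨R, hR.2, fun S hS hSk => ?_⟩
    obtain rfl := eq_of_subset_of_card_le hS (by omega)
    obtain ⟨A, hA, hSA⟩ := hcover S hSk
    exact ⟨A, hA, inter_eq_left.2 hSA⟩
  have hex : ∀ S : Finset (Fin n), ∃ A : Finset (Fin n), #S = k → A ∈ 𝓕 ∧ S ⊆ A := by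
    intro S
    by_cases hS : #S = k
    · obtain ⟨A, hA⟩ := hcover S hS
      exact ⟨A, fun _ => hA⟩
    · exact ⟨∅, fun h => absurd h hS⟩
  choose A hA using hex
  have hcard : ∀ S : Finset (Fin n), #S = k → #(A S) ≤ n / r ^ (k + 1) := by
    intro S hS
    rw [Nat.le_div_iff_mul_le hrpos]
    have := hsmall _ (hA S hS).1
    rw [le_div_iff₀ (by exact_mod_cast hrpos)] at this
    exact_mod_cast this
  have hkb : k ≤ n / r ^ (k + 1) := by
    obtain ⟨S, -, hS⟩ := exists_subset_card_eq (s := (univ : Finset (Fin n))) (n := k)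
      (by simp; omega)
    exact hS.symm.le.trans ((card_le_card (hA S hS).2).trans (hcard S hS))
  by_contra! hcon
  refine (choose_mul_lt_choose (b := n / r ^ (k + 1) - k) (by omega) hkr hrn ?_).not_ge ?_
  · rw [Nat.sub_add_cancel hkb]
    exact Nat.div_mul_le_self _ _
  · have := choose_le_of_forall_exists_mem_sdiff r k (n / r ^ (k + 1) - k) A ?_ ?_
    · simpa using this
    · intro S hS
      rw [card_sdiff_of_subset (hA S hS).2, hS]
      exact Nat.sub_le_sub_right (hcard S hS) k
    · intro R hR
      obtain ⟨S, hSR, hS, hne⟩ := hcon R hR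
      refine ⟨S, hSR, hS, ?_⟩
      by_contra! hv
      refine hne (A S) (hA S hS).1 (Subset.antisymm (fun x hx => ?_)
        (subset_inter hSR (hA S hS).2))
      by_contra hxS
      exact hv x (mem_sdiff.2 ⟨(mem_inter.1 hx).2, hxS⟩) (mem_inter.1 hx).1
end

section
/- Let D, h, k ≥ 2 be integers. Then there exists δ = δ(D, h, k) > 0 such that for all sufficiently large n the following holds: if 𝓕 ⊆ 𝒫([n]) is a family of subsets of [n] = {1, …, n} with |F| < δn for every F ∈ 𝓕, and 𝓕 does not k-shatter any subset of [n] of size h, then there exists a set I ⊆ [n] of size D such that |I ∩ F| < k for every F ∈ 𝓕. -/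
open Finset

/-- Ramsey's theorem for two-colourings of the `k`-subsets of a finite set. -/
theorem exists_ramsey_number (k D h : ℕ) :
    ∃ N : ℕ, ∀ (α : Type) [DecidableEq α] (X : Finset α) (c : Finset α → Prop), N ≤ X.card →
      ∃ I ⊆ X, (I.card = D ∧ ∀ S ⊆ I, S.card = k → ¬ c S) ∨
        (I.card = h ∧ ∀ S ⊆ I, S.card = k → c S) := by
  induction k generalizing D h with
  | zero =>
    refine ⟨max D h, fun α _ X c hX => ?_⟩
    by_cases hc : c ∅
    · obtain ⟨I, hI, hIc⟩ := Finset.exists_subset_card_eq ((le_max_right D h).trans hX)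
      refine ⟨I, hI, Or.inr ⟨hIc, fun S _ hS => ?_⟩⟩
      rwa [Finset.card_eq_zero.mp hS]
    · obtain ⟨I, hI, hIc⟩ := Finset.exists_subset_card_eq ((le_max_left D h).trans hX)
      refine ⟨I, hI, Or.inl ⟨hIc, fun S _ hS => ?_⟩⟩
      rwa [Finset.card_eq_zero.mp hS]
  | succ k ih =>
    have vacuous : ∀ (α : Type) [DecidableEq α] (S : Finset α), S ⊆ ∅ → S.card ≠ k + 1 := by
      intro α _ S hS
      simp [Finset.subset_empty.mp hS]
    have extend : ∀ (α : Type) [DecidableEq α] (Y I : Finset α) (v : α) (c : Finset α → Prop),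
        (∀ S ⊆ Y, S.card = k → c (insert v S)) → I ⊆ Y →
        (∀ S ⊆ I, S.card = k + 1 → c S) → ∀ S ⊆ insert v I, S.card = k + 1 → c S := by
      intro α _ Y I v c hY hIY hI S hS hSc
      by_cases hvS : v ∈ S
      · rw [← Finset.insert_erase hvS]
        refine hY _ ((Finset.subset_insert_iff.mp hS).trans hIY) ?_
        rw [Finset.card_erase_of_mem hvS, hSc, Nat.add_sub_cancel]
      · exact hI S ((Finset.subset_insert_iff_of_notMem hvS).mp hS) hSc
    induction D generalizing h with
    | zero =>
      exact ⟨0, fun α _ X c _ => ⟨∅, Finset.empty_subset _,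
        Or.inl ⟨rfl, fun S hS hSc => absurd hSc (vacuous α S hS)⟩⟩⟩
    | succ D ihD =>
      induction h with
      | zero =>
        exact ⟨0, fun α _ X c _ => ⟨∅, Finset.empty_subset _,
          Or.inr ⟨rfl, fun S hS hSc => absurd hSc (vacuous α S hS)⟩⟩⟩
      | succ h ihh =>
        obtain ⟨N₁, hN₁⟩ := ihD (h + 1)
        obtain ⟨N₂, hN₂⟩ := ihh
        obtain ⟨N, hN⟩ := ih N₁ N₂
        refine ⟨N + 1, fun α _ X c hX => ?_⟩
        obtain ⟨v, hv⟩ := Finset.card_pos.mp (Nat.succ_pos N |>.trans_le hX)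
        obtain ⟨Y, hYX, hY⟩ := hN α (X.erase v) (fun S => c (insert v S))
          (by rw [Finset.card_erase_of_mem hv]; omega)
        have hvY : v ∉ Y := fun hvY => Finset.notMem_erase v X (hYX hvY)
        have hYX' : Y ⊆ X := hYX.trans (Finset.erase_subset _ _)
        rcases hY with ⟨hYc, hY⟩ | ⟨hYc, hY⟩
        · obtain ⟨I, hIY, ⟨hIc, hI⟩ | hI⟩ := hN₁ α Y c hYc.ge
          · refine ⟨insert v I, Finset.insert_subset hv (hIY.trans hYX'), Or.inl ⟨?_, ?_⟩⟩
            · rw [Finset.card_insert_of_notMem fun hvI => hvY (hIY hvI), hIc]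
            · exact extend α Y I v (fun S => ¬ c S) hY hIY hI
          · exact ⟨I, hIY.trans hYX', Or.inr hI⟩
        · obtain ⟨I, hIY, hI | ⟨hIc, hI⟩⟩ := hN₂ α Y c hYc.ge
          · exact ⟨I, hIY.trans hYX', Or.inl hI⟩
          · refine ⟨insert v I, Finset.insert_subset hv (hIY.trans hYX'), Or.inr ⟨?_, ?_⟩⟩
            · rw [Finset.card_insert_of_notMem fun hvI => hvY (hIY hvI), hIc]
            · exact extend α Y I v c hY hIY hI

/-- If the set `G f` of forbidden values for `f j` does not depend on `f j` and has at most `M`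
elements, then at most an `M / |α|` proportion of the functions take a forbidden value at `j`. -/
theorem card_mul_card_filter_mem_le {ι α : Type*} [Fintype ι] [DecidableEq ι] [Fintype α]
    [DecidableEq α] (j : ι) (G : (ι → α) → Finset α) (M : ℕ)
    (hG : ∀ f x, G (Function.update f j x) = G f) (hM : ∀ f, (G f).card ≤ M) :
    Fintype.card α * (univ.filter fun f : ι → α => f j ∈ G f).card ≤
      Fintype.card (ι → α) * M := by
  calc Fintype.card α * (univ.filter fun f : ι → α => f j ∈ G f).card
      = ((univ.filter fun f : ι → α => f j ∈ G f) ×ˢ (univ : Finset α)).card := by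
        rw [Finset.card_product, Finset.card_univ, mul_comm]
    _ ≤ ((univ : Finset (ι → α)).sigma G).card := by
        refine Finset.card_le_card_of_injOn
          (fun p => ⟨Function.update p.1 j p.2, p.1 j⟩) ?_ ?_
        · rintro ⟨f, x⟩ hf
          simpa [hG] using hf
        · rintro ⟨f, x⟩ - ⟨g, y⟩ - hfg
          simp only [Sigma.mk.injEq, heq_eq_eq] at hfg
          obtain ⟨hupd, hj⟩ := hfg
          have hxy : x = y := by simpa using congrFun hupd j
          have hfg : f = g := by
            funext i
            by_cases hi : i = j
            · rw [hi, hj]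
            · simpa [hi] using congrFun hupd i
          rw [hxy, hfg]
    _ = ∑ f : ι → α, (G f).card := Finset.card_sigma _ _
    _ ≤ Fintype.card (ι → α) * M := by
        simpa using Finset.sum_le_card_nsmul univ (fun f => (G f).card) M fun f _ => hM f

/-- If every `F S` is small, some `N` points are distinct and each `F S`, for `S` among these
points, contains no further one of them. -/
theorem exists_injective_forall_notMem {α : Type*} [Fintype α] [DecidableEq α] (N m : ℕ)
    (F : Finset α → Finset α) (hF : ∀ S, (F S).card ≤ m)
    (hN : N * (2 ^ N * m + N) < Fintype.card α) :
    ∃ f : Fin N → α, Function.Injective f ∧ ∀ s : Finset (Fin N), ∀ j ∉ s, f j ∉ F (s.image f) := by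
  set M := 2 ^ N * m + N
  let G : Fin N → (Fin N → α) → Finset α := fun j f =>
    ((univ.erase j).powerset.biUnion fun s => F (s.image f)) ∪ (univ.erase j).image f
  have image_update : ∀ (j : Fin N) (f : Fin N → α) (x : α), ∀ s ⊆ univ.erase j,
      s.image (Function.update f j x) = s.image f := by
    intro j f x s hs
    refine Finset.image_congr fun i hi => ?_
    exact Function.update_of_ne (Finset.ne_of_mem_erase (hs hi)) _ _
  have hG : ∀ j f x, G j (Function.update f j x) = G j f := by
    intro j f x
    refine congrArg₂ (· ∪ ·) (Finset.biUnion_congr rfl fun s hs => ?_) (image_update j f x _ subset_rfl)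
    rw [image_update j f x s (Finset.mem_powerset.mp hs)]
  have hM : ∀ j f, (G j f).card ≤ M := by
    intro j f
    have hcard : (univ.erase j).card ≤ N := by
      simp
    refine (Finset.card_union_le _ _).trans (add_le_add ?_ (Finset.card_image_le.trans hcard))
    refine (Finset.card_biUnion_le_card_mul _ _ m fun s _ => hF _).trans ?_
    rw [Finset.card_powerset]
    gcongr
    norm_num
  obtain ⟨f, hf⟩ : ∃ f : Fin N → α, ∀ j, f j ∉ G j f := by
    by_contra! hbad
    have hα : 0 < Fintype.card α := (Nat.zero_le _).trans_lt hN
    have hcover : (univ : Finset (Fin N → α)) ⊆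
        univ.biUnion fun j => univ.filter fun f => f j ∈ G j f := fun f _ => by
      simpa using hbad f
    have hfun : 0 < Fintype.card (Fin N → α) := by
      rw [Fintype.card_fun]
      positivity
    have hle : Fintype.card α * Fintype.card (Fin N → α) ≤
        N * M * Fintype.card (Fin N → α) :=
      calc Fintype.card α * Fintype.card (Fin N → α)
          ≤ Fintype.card α * ∑ j, (univ.filter fun f : Fin N → α => f j ∈ G j f).card :=
            Nat.mul_le_mul_left _ ((Finset.card_le_card hcover).trans Finset.card_biUnion_le)
        _ = ∑ j, Fintype.card α * (univ.filter fun f : Fin N → α => f j ∈ G j f).card :=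
            Finset.mul_sum _ _ _
        _ ≤ ∑ _j : Fin N, Fintype.card (Fin N → α) * M :=
            Finset.sum_le_sum fun j _ => card_mul_card_filter_mem_le j (G j) M (hG j) (hM j)
        _ = N * M * Fintype.card (Fin N → α) := by
            rw [Finset.sum_const, Finset.card_univ, Fintype.card_fin, smul_eq_mul]
            ring
    exact absurd (Nat.le_of_mul_le_mul_right hle hfun) hN.not_ge
  refine ⟨f, fun i j hij => ?_, fun s j hj hmem => hf j ?_⟩
  · by_contra hne
    refine hf j (Finset.mem_union_right _ (Finset.mem_image.mpr ⟨i, ?_, hij⟩))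
    simpa using hne
  · refine Finset.mem_union_left _ (Finset.mem_biUnion.mpr ⟨s, ?_, hmem⟩)
    rw [Finset.mem_powerset]
    exact fun i hi => Finset.mem_erase.mpr ⟨fun hij => hj (hij ▸ hi), Finset.mem_univ i⟩

/-- For `D, h, k ≥ 2` there is `δ > 0` such that for all large `n`:
if every member of `𝓕 ⊆ 𝒫([n])` has size less than `δn` and `𝓕` does not `k`-shatter
any `h`-set, then some `D`-set `I` satisfies `|I ∩ F| < k` for all `F ∈ 𝓕`. -/
theorem stmt19 :
    ∀ D h k : ℕ, 2 ≤ D → 2 ≤ h → 2 ≤ k →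
      ∃ δ : ℝ, 0 < δ ∧ ∃ n₀ : ℕ, ∀ n : ℕ, n₀ ≤ n →
        ∀ 𝓕 : Set (Finset (Fin n)),
          (∀ A ∈ 𝓕, (A.card : ℝ) < δ * n) →
          (¬ ∃ R : Finset (Fin n), R.card = h ∧
              ∀ S : Finset (Fin n), S ⊆ R → S.card = k → ∃ A ∈ 𝓕, R ∩ A = S) →
          ∃ I : Finset (Fin n), I.card = D ∧ ∀ A ∈ 𝓕, (I ∩ A).card < k := by
  classical
  intro D h k _ _ _
  obtain ⟨N, hN⟩ := exists_ramsey_number k D h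
  have hδ : (0 : ℝ) < 1 / (2 ^ (N + 1) * (N + 1)) := by positivity
  refine ⟨1 / (2 ^ (N + 1) * (N + 1)), hδ, 2 * N ^ 2 + 1, ?_⟩
  generalize hδ_def : (1 : ℝ) / (2 ^ (N + 1) * (N + 1)) = δ at hδ
  intro n hn 𝓕 hsmall hshatter
  let F : Finset (Fin n) → Finset (Fin n) := fun S =>
    if hS : ∃ A ∈ 𝓕, S ⊆ A then hS.choose else ∅
  have hF : ∀ S, (∃ A ∈ 𝓕, S ⊆ A) → F S ∈ 𝓕 ∧ S ⊆ F S := by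
    intro S hS
    simp only [F, dif_pos hS]
    exact hS.choose_spec
  have hFcard : ∀ S, (F S).card ≤ ⌊δ * n⌋₊ := by
    intro S
    by_cases hS : ∃ A ∈ 𝓕, S ⊆ A
    · exact Nat.le_floor (hsmall _ (hF S hS).1).le
    · simp [F, dif_neg hS]
  have hsize : N * (2 ^ N * ⌊δ * n⌋₊ + N) < Fintype.card (Fin n) := by
    rw [Fintype.card_fin]
    have hfloor : (⌊δ * n⌋₊ : ℝ) ≤ δ * n := Nat.floor_le (by positivity)
    have hδN : N * 2 ^ N * δ ≤ 1 / 2 := by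
      rw [← hδ_def, mul_one_div, div_le_div_iff₀ (by positivity) (by norm_num), pow_succ]
      nlinarith [show (0 : ℝ) < 2 ^ N by positivity]
    have hn' : (2 * N ^ 2 + 1 : ℝ) ≤ n := by exact_mod_cast hn
    have : (N * (2 ^ N * ⌊δ * n⌋₊ + N) : ℝ) < n :=
      calc (N * (2 ^ N * ⌊δ * n⌋₊ + N) : ℝ) ≤ N * (2 ^ N * (δ * n) + N) := by gcongr
        _ = N * 2 ^ N * δ * n + N ^ 2 := by ring
        _ ≤ 1 / 2 * n + N ^ 2 := by gcongr
        _ < n := by linarith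
    exact_mod_cast this
  obtain ⟨f, hfinj, hf⟩ := exists_injective_forall_notMem N _ F hFcard hsize
  obtain ⟨I, hIX, ⟨hIc, hI⟩ | ⟨hIc, hI⟩⟩ :=
    hN (Fin n) (univ.image f) (fun S => ∃ A ∈ 𝓕, S ⊆ A)
      (by simp [Finset.card_image_of_injective _ hfinj])
  · refine ⟨I, hIc, fun A hA => ?_⟩
    by_contra! hk
    obtain ⟨S, hS, hSc⟩ := Finset.exists_subset_card_eq hk
    exact hI S (hS.trans Finset.inter_subset_left) hSc ⟨A, hA, hS.trans Finset.inter_subset_right⟩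
  · refine absurd ⟨I, hIc, fun S hSI hSc => ?_⟩ hshatter
    obtain ⟨hFmem, hSF⟩ := hF S (hI S hSI hSc)
    refine ⟨F S, hFmem, Finset.Subset.antisymm (fun x hx => ?_) (Finset.subset_inter hSI hSF)⟩
    obtain ⟨hxI, hxF⟩ := Finset.mem_inter.mp hx
    obtain ⟨s, -, rfl⟩ := Finset.subset_image_iff.mp (hSI.trans hIX)
    obtain ⟨j, -, rfl⟩ := Finset.mem_image.mp (hIX hxI)
    by_contra hj
    exact hf s j (fun hjs => hj (Finset.mem_image_of_mem f hjs)) hxF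
end
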